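/- arXiv:1303.3424 — 5 statements merged into one kernel-verified Lean document; each statement's English description precedes it below -/
import Mathlib

section
/- Let 0<α<n, 1<p<q<∞, let 𝒟 be a dyadic grid in ℝ^n, and let (u,σ) be a pair of weights. Then the outer testing constant satisfies [u,σ]_{I_α^{out},p,q} ≤ (1−2^{α−n})^{−1}·‖M_α(·σ)‖_{L^p(σ)→L^q(u)}, and dually [σ,u]_{I_α^{out},q',p'} ≤ (1−2^{α−n})^{−1}·‖M_α(·u)‖_{L^{q'}(u)→L^{p'}(σ)}. -/
open MeasureTheory ENNReal Set

noncomputable section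

/-- `ℝ^n` with Lebesgue measure. -/
abbrev Rn (n : ℕ) : Type := Fin n → ℝ

/-- An axis-parallel (half-open) cube in `ℝ^n`. -/
structure Cube (n : ℕ) where
  corner : Fin n → ℝ
  side : ℝ
  side_pos : 0 < side

/-- The underlying set of a cube. -/
def Cube.set {n : ℕ} (Q : Cube n) : Set (Rn n) :=
  {x | ∀ i, Q.corner i ≤ x i ∧ x i < Q.corner i + Q.side}

/-- The volume `|Q|` of a cube. -/
def Cube.vol {n : ℕ} (Q : Cube n) : ℝ := Q.side ^ n

/-- Conjugate exponent `p' = p/(p-1)`. -/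
def conjExp (p : ℝ) : ℝ := p / (p - 1)

/-- Average over a cube of an `ℝ≥0∞`-valued function. -/
def avgE {n : ℕ} (Q : Cube n) (g : Rn n → ℝ≥0∞) : ℝ≥0∞ :=
  (∫⁻ x in Q.set, g x) / ENNReal.ofReal Q.vol

/-- Average over a cube of a (nonnegative) real weight. -/
def avgW {n : ℕ} (Q : Cube n) (w : Rn n → ℝ) : ℝ≥0∞ :=
  avgE Q fun x => ENNReal.ofReal (w x)

/-- Weighted `L^p` norm `‖f‖_{L^p(w)}` of an `ℝ≥0∞`-valued function. -/
def LpW {n : ℕ} (f : Rn n → ℝ≥0∞) (p : ℝ) (w : Rn n → ℝ) : ℝ≥0∞ :=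
  (∫⁻ x, f x ^ p * ENNReal.ofReal (w x)) ^ (1 / p)

/-- Weighted weak `L^q` quasinorm `‖f‖_{L^{q,∞}(w)}`. -/
def WeakLpW {n : ℕ} (f : Rn n → ℝ≥0∞) (q : ℝ) (w : Rn n → ℝ) : ℝ≥0∞ :=
  ⨆ (t : ℝ) (_ : 0 < t),
    ENNReal.ofReal t *
      (∫⁻ x in {x | ENNReal.ofReal t < f x}, ENNReal.ofReal (w x)) ^ (1 / q)

/-- The fractional maximal operator `M_α`. -/
def fracMax {n : ℕ} (α : ℝ) (f : Rn n → ℝ≥0∞) (x : Rn n) : ℝ≥0∞ :=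
  ⨆ (Q : Cube n) (_ : x ∈ Q.set),
    ENNReal.ofReal (Q.vol ^ (α / n - 1)) * ∫⁻ y in Q.set, f y

/-- The Euclidean norm on `ℝ^n`. -/
def eucNorm {n : ℕ} (x : Rn n) : ℝ := Real.sqrt (∑ i, x i ^ 2)

/-- The Riesz potential `I_α`. -/
def riesz {n : ℕ} (α : ℝ) (f : Rn n → ℝ≥0∞) (x : Rn n) : ℝ≥0∞ :=
  ∫⁻ y, f y * ENNReal.ofReal (eucNorm (x - y) ^ (α - n))

/-- The product `fσ` of an `ℝ≥0∞`-valued function with a weight. -/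
def mulW {n : ℕ} (f : Rn n → ℝ≥0∞) (w : Rn n → ℝ) : Rn n → ℝ≥0∞ :=
  fun x => f x * ENNReal.ofReal (w x)

/-- The operator norm `‖T(·σ)‖_{L^p(σ) → L^q(u)}` (least admissible constant). -/
def opNormStrong {n : ℕ} (T : (Rn n → ℝ≥0∞) → Rn n → ℝ≥0∞) (p q : ℝ)
    (σ u : Rn n → ℝ) : ℝ≥0∞ :=
  ⨆ (f : Rn n → ℝ≥0∞) (_ : Measurable f), LpW (T (mulW f σ)) q u / LpW f p σ

/-- The weak-type operator norm `‖T(·σ)‖_{L^p(σ) → L^{q,∞}(u)}`. -/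
def opNormWeak {n : ℕ} (T : (Rn n → ℝ≥0∞) → Rn n → ℝ≥0∞) (p q : ℝ)
    (σ u : Rn n → ℝ) : ℝ≥0∞ :=
  ⨆ (f : Rn n → ℝ≥0∞) (_ : Measurable f), WeakLpW (T (mulW f σ)) q u / LpW f p σ

/-- The operator norm `‖T‖_{L^p(v) → L^q(u)}` (no multiplication by the weight). -/
def opNormPlain {n : ℕ} (T : (Rn n → ℝ≥0∞) → Rn n → ℝ≥0∞) (p q : ℝ)
    (v u : Rn n → ℝ) : ℝ≥0∞ :=
  ⨆ (f : Rn n → ℝ≥0∞) (_ : Measurable f), LpW (T f) q u / LpW f p v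

/-- The weak-type operator norm `‖T‖_{L^p(v) → L^{q,∞}(u)}`. -/
def opNormPlainWeak {n : ℕ} (T : (Rn n → ℝ≥0∞) → Rn n → ℝ≥0∞) (p q : ℝ)
    (v u : Rn n → ℝ) : ℝ≥0∞ :=
  ⨆ (f : Rn n → ℝ≥0∞) (_ : Measurable f), WeakLpW (T f) q u / LpW f p v

/-- A weight: a nonnegative locally integrable (measurable) function. -/
def IsWeight {n : ℕ} (w : Rn n → ℝ) : Prop :=
  Measurable w ∧ (∀ x, 0 ≤ w x) ∧ LocallyIntegrable w volume

/-- The local `A^α_{p,q}` functional `A^α_{p,q}(u,σ,Q)`. -/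
def ApqQ {n : ℕ} (α p q : ℝ) (u σ : Rn n → ℝ) (Q : Cube n) : ℝ≥0∞ :=
  ENNReal.ofReal (Q.vol ^ (α / n + 1 / q - 1 / p)) * avgW Q u ^ (1 / q) *
    avgW Q σ ^ (1 / conjExp p)

/-- The joint constant `[u,σ]_{A^α_{p,q}}`. -/
def Apq {n : ℕ} (α p q : ℝ) (u σ : Rn n → ℝ) : ℝ≥0∞ :=
  ⨆ Q : Cube n, ApqQ α p q u σ Q

/-- `A^α_{p,q}` for `ℝ≥0∞`-valued weights. -/
def ApqE {n : ℕ} (α p q : ℝ) (u σ : Rn n → ℝ≥0∞) : ℝ≥0∞ :=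
  ⨆ Q : Cube n,
    ENNReal.ofReal (Q.vol ^ (α / n + 1 / q - 1 / p)) * avgE Q u ^ (1 / q) *
      avgE Q σ ^ (1 / conjExp p)

/-- Real-valued average over a cube. -/
def avgR {n : ℕ} (Q : Cube n) (w : Rn n → ℝ) : ℝ := (∫ x in Q.set, w x) / Q.vol

/-- The local exponential `A_∞` functional `A^{exp}_∞(w,Q)`. -/
def AexpQ {n : ℕ} (Q : Cube n) (w : Rn n → ℝ) : ℝ :=
  avgR Q w * Real.exp (- avgR Q fun x => Real.log (w x))

/-- `w ∈ A_∞` (exponential definition). -/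
def IsAinf {n : ℕ} (w : Rn n → ℝ) : Prop :=
  ∃ C : ℝ, ∀ Q : Cube n,
    IntegrableOn (fun x => Real.log (w x)) Q.set volume ∧ AexpQ Q w ≤ C

/-- The local Fujii–Wilson functional `A^M_∞(w,Q) = w(Q)⁻¹ ∫_Q M(wχ_Q)`. -/
def FWQ {n : ℕ} (Q : Cube n) (w : Rn n → ℝ) : ℝ≥0∞ :=
  (∫⁻ x in Q.set, fracMax 0 (Q.set.indicator fun y => ENNReal.ofReal (w y)) x) /
    ∫⁻ x in Q.set, ENNReal.ofReal (w x)

/-- The Fujii–Wilson constant `[w]_{A^M_∞}`. -/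
def FW {n : ℕ} (w : Rn n → ℝ) : ℝ≥0∞ := ⨆ Q : Cube n, FWQ Q w

/-- The local Muckenhoupt `A_r` functional. -/
def ArQ {n : ℕ} (r : ℝ) (v : Rn n → ℝ) (Q : Cube n) : ℝ≥0∞ :=
  avgW Q v * (avgE Q fun x => ENNReal.ofReal (v x) ^ (1 - conjExp r)) ^ (r - 1)

/-- The Muckenhoupt constant `[v]_{A_r}`. -/
def ArC {n : ℕ} (r : ℝ) (v : Rn n → ℝ) : ℝ≥0∞ := ⨆ Q : Cube n, ArQ r v Q

/-- The mixed constant `[v]_{(A_r)^β (A^M_∞)^γ}`. -/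
def mixedC {n : ℕ} (r β γ : ℝ) (v : Rn n → ℝ) : ℝ≥0∞ :=
  ⨆ Q : Cube n, ArQ r v Q ^ β * FWQ Q v ^ γ

/-- `Φ(t) = 1 + log t` applied to an `ℝ≥0∞` constant. -/
def PhiLog (X : ℝ≥0∞) : ℝ≥0∞ :=
  if X = ∞ then ∞ else ENNReal.ofReal (1 + Real.log X.toReal)

/-- A Young function. -/
def IsYoung (Φ : ℝ → ℝ) : Prop :=
  ContinuousOn Φ (Ici 0) ∧ ConvexOn ℝ (Ici 0) Φ ∧ StrictMonoOn Φ (Ici 0) ∧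
    Φ 0 = 0 ∧ Filter.Tendsto (fun t => Φ t / t) Filter.atTop Filter.atTop

/-- The associate (conjugate) Young function `Φ̄(t) = sup_{s>0} (st - Φ(s))`. -/
def assocFn (Φ : ℝ → ℝ) (t : ℝ) : ℝ :=
  sSup {y : ℝ | ∃ s : ℝ, 0 < s ∧ y = s * t - Φ s}

/-- The localized Luxemburg average `‖f‖_{Φ,Q}`. -/
def luxNorm {n : ℕ} (Φ : ℝ → ℝ) (Q : Cube n) (f : Rn n → ℝ) : ℝ≥0∞ :=
  sInf ((fun l : ℝ => ENNReal.ofReal l) ''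
    {l : ℝ | 0 < l ∧
      (∫⁻ x in Q.set, ENNReal.ofReal (Φ (|f x| / l))) ≤ ENNReal.ofReal Q.vol})

/-- The fractional Orlicz maximal operator `M_{β,Φ}`. -/
def orliczMax {n : ℕ} (β : ℝ) (Φ : ℝ → ℝ) (f : Rn n → ℝ) (x : Rn n) : ℝ≥0∞ :=
  ⨆ (Q : Cube n) (_ : x ∈ Q.set), ENNReal.ofReal (Q.vol ^ (β / n)) * luxNorm Φ Q f

/-- Unweighted `L^p` norm of a real function. -/
def Lp0 {n : ℕ} (f : Rn n → ℝ) (p : ℝ) : ℝ≥0∞ :=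
  (∫⁻ x, ENNReal.ofReal |f x| ^ p) ^ (1 / p)

/-- Unweighted `L^p` norm of an `ℝ≥0∞`-valued function. -/
def LpE {n : ℕ} (g : Rn n → ℝ≥0∞) (p : ℝ) : ℝ≥0∞ :=
  (∫⁻ x, g x ^ p) ^ (1 / p)

/-- The unweighted operator norm `‖M_{β,Φ}‖_{L^p → L^q}`. -/
def orliczMaxNorm (n : ℕ) (β : ℝ) (Φ : ℝ → ℝ) (p q : ℝ) : ℝ≥0∞ :=
  ⨆ (f : Rn n → ℝ) (_ : Measurable f), LpE (orliczMax β Φ f) q / Lp0 f p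

/-- The `B^β_p` integral `∫_c^∞ Φ(t)^{q/p} t^{-q} dt/t`, where `1/q = 1/p - β/n`. -/
def BInt (Φ : ℝ → ℝ) (p q : ℝ) (c : ℝ) : ℝ≥0∞ :=
  ∫⁻ t in Ioi c, ENNReal.ofReal (Φ t ^ (q / p) * t ^ (-q) / t)

/-- The `B^β_p` condition (with `q` given by `1/q = 1/p - β/n`). -/
def BCond (Φ : ℝ → ℝ) (p q : ℝ) : Prop := ∃ c : ℝ, 0 < c ∧ BInt Φ p q c < ∞

/-- The bump constant `[u,σ]_{A^α_{p,q,Φ}}`. -/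
def bumpA {n : ℕ} (α p q : ℝ) (Φ : ℝ → ℝ) (u σ : Rn n → ℝ) : ℝ≥0∞ :=
  ⨆ Q : Cube n,
    ENNReal.ofReal (Q.vol ^ (α / n + 1 / q - 1 / p)) * avgW Q u ^ (1 / q) *
      luxNorm Φ Q (fun x => σ x ^ (1 / conjExp p))

/-- A dyadic grid in `ℝ^n`. -/
def IsDyadicGrid {n : ℕ} (D : Set (Cube n)) : Prop :=
  (∀ Q ∈ D, ∃ k : ℤ, Q.side = (2 : ℝ) ^ k) ∧
  (∀ Q ∈ D, ∀ P ∈ D, Q.set ∩ P.set = P.set ∨ Q.set ∩ P.set = Q.set ∨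
    Q.set ∩ P.set = ∅) ∧
  (∀ k : ℤ, ∀ x : Rn n, ∃! Q : Cube n, Q ∈ D ∧ Q.side = (2 : ℝ) ^ k ∧ x ∈ Q.set)

/-- The outer dyadic Riesz potential `I_α^{Q₀}`. -/
def outerRiesz {n : ℕ} (D : Set (Cube n)) (α : ℝ) (Q₀ : Cube n)
    (f : Rn n → ℝ≥0∞) (x : Rn n) : ℝ≥0∞ :=
  ∑' Q : {Q : Cube n // Q ∈ D ∧ Q₀.set ⊆ Q.set},
    Q.1.set.indicator
      (fun _ => ENNReal.ofReal (Q.1.vol ^ (α / n - 1)) * ∫⁻ y in Q.1.set, f y) x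

/-- The outer testing constant `[u,σ]_{I_α^{out},p,q}`. -/
def outerTest {n : ℕ} (D : Set (Cube n)) (α p q : ℝ) (u σ : Rn n → ℝ) : ℝ≥0∞ :=
  ⨆ (Q₀ : Cube n) (_ : Q₀ ∈ D),
    (∫⁻ x, outerRiesz D α Q₀ (Q₀.set.indicator fun y => ENNReal.ofReal (σ y)) x ^ q *
        ENNReal.ofReal (u x)) ^ (1 / q) /
      (∫⁻ x in Q₀.set, ENNReal.ofReal (σ x)) ^ (1 / p)

/-- The dyadic fractional maximal operator `M_α^𝒟`. -/
def dyadicFracMax {n : ℕ} (D : Set (Cube n)) (α : ℝ) (f : Rn n → ℝ≥0∞)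
    (x : Rn n) : ℝ≥0∞ :=
  ⨆ (Q : Cube n) (_ : Q ∈ D) (_ : x ∈ Q.set),
    ENNReal.ofReal (Q.vol ^ (α / n - 1)) * ∫⁻ y in Q.set, f y

/-- A sparse family `S ⊆ D` with associated disjoint thick subsets `E Q ⊆ Q`. -/
def IsSparse {n : ℕ} (D S : Set (Cube n)) (E : Cube n → Set (Rn n)) : Prop :=
  S ⊆ D ∧
  (∀ Q ∈ S, E Q ⊆ Q.set ∧ MeasurableSet (E Q) ∧
    ENNReal.ofReal Q.vol ≤ 2 * volume (E Q)) ∧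
  S.PairwiseDisjoint E

/-- The sparse operator `L_α^S`. -/
def sparseOp {n : ℕ} (S : Set (Cube n)) (E : Cube n → Set (Rn n)) (α : ℝ)
    (f : Rn n → ℝ≥0∞) (x : Rn n) : ℝ≥0∞ :=
  ∑' Q : S,
    (E Q.1).indicator
      (fun _ => ENNReal.ofReal (Q.1.vol ^ (α / n - 1)) * ∫⁻ y in Q.1.set, f y) x

/-- The one-dimensional fractional maximal operator over bounded intervals. -/
def fm1 (γ : ℝ) (f : ℝ → ℝ≥0∞) (x : ℝ) : ℝ≥0∞ :=
  ⨆ (a : ℝ) (b : ℝ) (_ : a < b) (_ : x ∈ Icc a b),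
    ENNReal.ofReal ((b - a) ^ (γ - 1)) * ∫⁻ y in Ioo a b, f y

lemma Cube.measurableSet_set {n : ℕ} (Q : Cube n) : MeasurableSet Q.set := by
  have h : Q.set = Set.pi univ fun i => Ico (Q.corner i) (Q.corner i + Q.side) := by
    ext x
    simp [Cube.set]
  rw [h]
  exact MeasurableSet.univ_pi fun i => measurableSet_Ico

lemma Cube.side_le_of_subset {n : ℕ} (hn : 0 < n) {P Q : Cube n} (h : P.set ⊆ Q.set) :
    P.side ≤ Q.side := by
  by_contra! hlt
  have h₁ : P.corner ∈ Q.set := h fun i => ⟨le_rfl, by linarith [P.side_pos]⟩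
  have h₂ : (fun i => P.corner i + Q.side) ∈ Q.set :=
    h fun i => ⟨by linarith [Q.side_pos], by linarith⟩
  have h₃ := (h₁ ⟨0, hn⟩).1
  have h₄ := (h₂ ⟨0, hn⟩).2
  linarith

lemma Cube.vol_rpow {n : ℕ} (hn : 0 < n) (Q : Cube n) (α : ℝ) :
    Q.vol ^ (α / n - 1) = Q.side ^ (α - n) := by
  have hn' : (n : ℝ) ≠ 0 := by positivity
  rw [Cube.vol, ← Real.rpow_natCast, ← Real.rpow_mul Q.side_pos.le]
  congr 1
  field_simp

lemma IsDyadicGrid.eq_of_side_eq {n : ℕ} {D : Set (Cube n)} (hD : IsDyadicGrid D)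
    {P Q : Cube n} (hP : P ∈ D) (hQ : Q ∈ D) (h : P.side = Q.side) {x : Rn n}
    (hxP : x ∈ P.set) (hxQ : x ∈ Q.set) : P = Q := by
  obtain ⟨k, hk⟩ := hD.1 Q hQ
  exact (hD.2.2 k x).unique ⟨hP, h.trans hk, hxP⟩ ⟨hQ, hk, hxQ⟩

/-- Among the cubes of a grid that contain a fixed cube and satisfy a further condition, one has
least side length, and all other side lengths are multiples of it by powers of two. -/
lemma IsDyadicGrid.exists_minimal {n : ℕ} (hn : 0 < n) {D : Set (Cube n)}
    (hD : IsDyadicGrid D) {Q₀ : Cube n} (hQ₀ : Q₀ ∈ D) {S : Set (Cube n)} (hS : S.Nonempty)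
    (hSD : ∀ Q ∈ S, Q ∈ D ∧ Q₀.set ⊆ Q.set) :
    ∃ P ∈ S, ∀ Q ∈ S, ∃ l : ℕ, Q.side = P.side * 2 ^ l := by
  classical
  obtain ⟨j, hj⟩ := hD.1 Q₀ hQ₀
  have key : ∀ Q ∈ S, ∃ m : ℕ, Q.side = (2 : ℝ) ^ j * 2 ^ m := by
    intro Q hQ
    obtain ⟨k, hk⟩ := hD.1 Q (hSD Q hQ).1
    have hle := Cube.side_le_of_subset hn (hSD Q hQ).2
    rw [hj, hk, zpow_le_zpow_iff_right₀ _root_.one_lt_two] at hle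
    obtain ⟨m, rfl⟩ := Int.le.dest hle
    exact ⟨m, by rw [hk, zpow_add₀ two_ne_zero, zpow_natCast]⟩
  have hex : ∃ m : ℕ, ∃ Q ∈ S, Q.side = (2 : ℝ) ^ j * 2 ^ m := by
    obtain ⟨Q, hQ⟩ := hS
    obtain ⟨m, hm⟩ := key Q hQ
    exact ⟨m, Q, hQ, hm⟩
  obtain ⟨P, hP, hPs⟩ := Nat.find_spec hex
  refine ⟨P, hP, fun Q hQ => ?_⟩
  obtain ⟨m, hm⟩ := key Q hQ
  obtain ⟨l, hl⟩ := Nat.exists_eq_add_of_le (Nat.find_min' hex ⟨Q, hQ, hm⟩)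
  exact ⟨l, by rw [hm, hPs, mul_assoc, ← pow_add, ← hl]⟩

lemma tsum_ofReal_geometric {r : ℝ} (h₀ : 0 ≤ r) (h₁ : r < 1) :
    ∑' l : ℕ, ENNReal.ofReal (r ^ l) = ENNReal.ofReal (1 - r)⁻¹ := by
  rw [← ENNReal.ofReal_tsum_of_nonneg (fun l => pow_nonneg h₀ l)
    (summable_geometric_of_lt_one h₀ h₁), tsum_geometric_of_lt_one h₀ h₁]

lemma outerRiesz_indicator_le {n : ℕ} (hn : 0 < n) {α : ℝ} (hαn : α < n)
    {D : Set (Cube n)} (hD : IsDyadicGrid D) {Q₀ : Cube n} (hQ₀ : Q₀ ∈ D)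
    (g : Rn n → ℝ≥0∞) (x : Rn n) :
    outerRiesz D α Q₀ (Q₀.set.indicator g) x ≤
      ENNReal.ofReal (1 - (2 : ℝ) ^ (α - n))⁻¹ * fracMax α (Q₀.set.indicator g) x := by
  set S : Set (Cube n) := {Q | (Q ∈ D ∧ Q₀.set ⊆ Q.set) ∧ x ∈ Q.set} with hS
  set I : ℝ≥0∞ := ∫⁻ y in Q₀.set, g y
  have hint : ∀ Q : Cube n, Q₀.set ⊆ Q.set → ∫⁻ y in Q.set, Q₀.set.indicator g y = I := by
    intro Q hQ
    rw [setLIntegral_indicator Q₀.measurableSet_set, inter_eq_left.mpr hQ]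
  have hsum : outerRiesz D α Q₀ (Q₀.set.indicator g) x =
      ∑' Q : S, ENNReal.ofReal (Q.1.side ^ (α - n)) * I := by
    have h := tsum_subtype {Q : Cube n | Q ∈ D ∧ Q₀.set ⊆ Q.set} fun Q : Cube n =>
      Q.set.indicator (fun _ => ENNReal.ofReal (Q.vol ^ (α / n - 1)) *
        ∫⁻ y in Q.set, Q₀.set.indicator g y) x
    refine h.trans ?_
    rw [tsum_subtype S fun Q : Cube n => ENNReal.ofReal (Q.side ^ (α - n)) * I]
    refine tsum_congr fun Q => ?_
    by_cases h₁ : Q ∈ D ∧ Q₀.set ⊆ Q.set <;> by_cases h₂ : x ∈ Q.set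
    · rw [indicator_of_mem (show Q ∈ {Q : Cube n | Q ∈ D ∧ Q₀.set ⊆ Q.set} from h₁),
        indicator_of_mem h₂, indicator_of_mem (show Q ∈ S from ⟨h₁, h₂⟩), hint Q h₁.2,
        Q.vol_rpow hn]
    all_goals simp [hS, indicator, h₁, h₂]
  rw [hsum]
  rcases S.eq_empty_or_nonempty with hSe | hSne
  · have : IsEmpty S := isEmpty_coe_sort.mpr hSe
    simp
  obtain ⟨P, hP, hPmin⟩ := hD.exists_minimal hn hQ₀ hSne fun Q hQ => hQ.1
  choose l hl using fun Q : S => hPmin Q.1 Q.2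
  have hinj : Function.Injective l := by
    intro Q R h
    refine Subtype.ext (hD.eq_of_side_eq Q.2.1.1 R.2.1.1 ?_ Q.2.2 R.2.2)
    rw [hl Q, hl R, h]
  have h2 : (0 : ℝ) < 2 ^ (α - n) := by positivity
  have hterm : ∀ Q : S, ENNReal.ofReal (Q.1.side ^ (α - n)) * I =
      ENNReal.ofReal (((2 : ℝ) ^ (α - n)) ^ l Q) *
        (ENNReal.ofReal (P.side ^ (α - n)) * I) := by
    intro Q
    rw [← mul_assoc, ← ENNReal.ofReal_mul (by positivity), hl Q,
      Real.mul_rpow P.side_pos.le (by positivity), mul_comm,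
      ← Real.rpow_natCast, ← Real.rpow_natCast, ← Real.rpow_mul zero_le_two,
      ← Real.rpow_mul zero_le_two, mul_comm (α - n), mul_comm I, mul_comm (P.side ^ _)]
  calc ∑' Q : S, ENNReal.ofReal (Q.1.side ^ (α - n)) * I
      = (∑' Q : S, ENNReal.ofReal (((2 : ℝ) ^ (α - n)) ^ l Q)) *
          (ENNReal.ofReal (P.side ^ (α - n)) * I) := by
        rw [← ENNReal.tsum_mul_right]
        exact tsum_congr hterm
    _ ≤ (∑' k : ℕ, ENNReal.ofReal (((2 : ℝ) ^ (α - n)) ^ k)) *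
          (ENNReal.ofReal (P.side ^ (α - n)) * I) := by
        gcongr
        exact ENNReal.tsum_comp_le_tsum_of_injective hinj _
    _ = ENNReal.ofReal (1 - (2 : ℝ) ^ (α - n))⁻¹ *
          (ENNReal.ofReal (P.side ^ (α - n)) * I) := by
        rw [tsum_ofReal_geometric h2.le
          (Real.rpow_lt_one_of_one_lt_of_neg one_lt_two (by linarith))]
    _ ≤ _ := by
        gcongr
        rw [← P.vol_rpow hn, ← hint P hP.1.2]
        exact le_iSup₂_of_le P hP.2 le_rfl

lemma outerTest_le_opNormStrong {n : ℕ} (hn : 0 < n) {α p q : ℝ} (hαn : α < n)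
    (hp : 0 < p) (hq : 0 < q) {D : Set (Cube n)} (hD : IsDyadicGrid D) (u σ : Rn n → ℝ) :
    outerTest D α p q u σ ≤
      ENNReal.ofReal (1 - (2 : ℝ) ^ (α - n))⁻¹ * opNormStrong (fracMax α) p q σ u := by
  refine iSup₂_le fun Q₀ hQ₀ => ?_
  set C : ℝ≥0∞ := ENNReal.ofReal (1 - (2 : ℝ) ^ (α - n))⁻¹
  set χ : Rn n → ℝ≥0∞ := Q₀.set.indicator 1 with hχ
  have hmul : mulW χ σ = Q₀.set.indicator fun y => ENNReal.ofReal (σ y) := by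
    ext y
    by_cases hy : y ∈ Q₀.set <;> simp [mulW, hχ, hy]
  have hnorm : LpW χ p σ = (∫⁻ x in Q₀.set, ENNReal.ofReal (σ x)) ^ (1 / p) := by
    rw [LpW, ← lintegral_indicator Q₀.measurableSet_set]
    congr 2
    ext y
    by_cases hy : y ∈ Q₀.set <;> simp [hχ, hy, hp]
  have hnum : (∫⁻ x, outerRiesz D α Q₀ (Q₀.set.indicator fun y => ENNReal.ofReal (σ y)) x ^ q *
      ENNReal.ofReal (u x)) ^ (1 / q) ≤ C * LpW (fracMax α (mulW χ σ)) q u := by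
    calc _ ≤ (∫⁻ x, C ^ q * (fracMax α (mulW χ σ) x ^ q * ENNReal.ofReal (u x))) ^ (1 / q) := by
          refine ENNReal.rpow_le_rpow (lintegral_mono fun x => ?_) (by positivity)
          rw [← mul_assoc, ← ENNReal.mul_rpow_of_nonneg _ _ hq.le, hmul]
          gcongr
          exact outerRiesz_indicator_le hn hαn hD hQ₀ _ x
      _ = C * LpW (fracMax α (mulW χ σ)) q u := by
          rw [lintegral_const_mul' _ _ (ENNReal.rpow_ne_top_of_nonneg hq.le ENNReal.ofReal_ne_top),
            ENNReal.mul_rpow_of_nonneg _ _ (by positivity), one_div,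
            ENNReal.rpow_rpow_inv hq.ne', LpW, one_div]
  calc _ ≤ C * LpW (fracMax α (mulW χ σ)) q u / LpW χ p σ := by
        rw [hnorm]
        gcongr
    _ ≤ C * opNormStrong (fracMax α) p q σ u := by
        rw [mul_div_assoc]
        gcongr
        exact le_iSup₂_of_le χ (measurable_one.indicator Q₀.measurableSet_set) le_rfl

/-- outer testing constants are controlled by fractional maximal norms:
for any dyadic grid `𝒟`, `[u,σ]_{I_α^{out},p,q} ≤ (1-2^{α-n})⁻¹ ‖M_α(·σ)‖_{L^p(σ)→L^q(u)}`
and dually `[σ,u]_{I_α^{out},q',p'} ≤ (1-2^{α-n})⁻¹ ‖M_α(·u)‖_{L^{q'}(u)→L^{p'}(σ)}`. -/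
theorem stmt14 (n : ℕ) (hn : 0 < n) (α p q : ℝ) (hα : 0 < α) (hαn : α < n)
    (hp : 1 < p) (hpq : p < q) (D : Set (Cube n)) (hD : IsDyadicGrid D)
    (u σ : Rn n → ℝ) (hu : IsWeight u) (hσ : IsWeight σ) :
    outerTest D α p q u σ ≤
        ENNReal.ofReal (1 - (2 : ℝ) ^ (α - n))⁻¹ * opNormStrong (fracMax α) p q σ u ∧
      outerTest D α (conjExp q) (conjExp p) σ u ≤
        ENNReal.ofReal (1 - (2 : ℝ) ^ (α - n))⁻¹ *
          opNormStrong (fracMax α) (conjExp q) (conjExp p) u σ := by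
  have hq : 1 < q := hp.trans hpq
  have conj_pos : ∀ {r : ℝ}, 1 < r → 0 < conjExp r := fun hr =>
    div_pos (by linarith) (by linarith)
  exact ⟨outerTest_le_opNormStrong hn hαn (by linarith) (by linarith) hD u σ,
    outerTest_le_opNormStrong hn hαn (conj_pos hq) (conj_pos hp) hD σ u⟩
end
end

section
/- Let 0<α<n, 1<p<q<∞, and let (u,σ) be a pair of weights on ℝ^n. Then the Sawyer testing constant for the fractional maximal operator satisfies [σ,u]_{M_α,q',p'} = sup_Q (∫_Q M_α(uχ_Q)^{p'}σ dx)^{1/p'}·u(Q)^{−1/q'} ≤ C·‖I_α(·σ)‖_{L^p(σ)→L^{q,∞}(u)}, where the supremum is over all cubes Q and C depends only on n, α, p and q. -/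
open MeasureTheory ENNReal Set

noncomputable section

/-- A weak-type `L^q` bound on a finite measure space controls the integral. -/
lemma lintegral_le_of_weak_bound {X : Type*} [MeasurableSpace X] (μ : Measure X)
    [IsFiniteMeasure μ] {G : X → ℝ≥0∞} (hG : Measurable G) {q w : ℝ} (hq : 1 < q) (hw : 0 < w)
    (h : ∀ t : ℝ, 0 < t →
      ENNReal.ofReal t * μ {x | ENNReal.ofReal t < G x} ^ (1 / q) ≤ ENNReal.ofReal w) :
    ∫⁻ x, G x ∂μ ≤
      ENNReal.ofReal (conjExp q) * ENNReal.ofReal w * μ univ ^ (1 / conjExp q) := by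
  have hq0 : 0 < q := by linarith
  rcases eq_or_ne μ 0 with rfl | hμ
  · simp
  have hdist : ∀ t : ℝ, 0 < t →
      μ {x | ENNReal.ofReal t < G x} ≤ ENNReal.ofReal (w ^ q * t ^ (-q)) := by
    intro t ht
    have h1 := ENNReal.rpow_le_rpow (h t ht) hq0.le
    rw [ENNReal.mul_rpow_of_nonneg _ _ hq0.le, ← ENNReal.rpow_mul, one_div,
      inv_mul_cancel₀ hq0.ne', ENNReal.rpow_one, ENNReal.ofReal_rpow_of_pos ht,
      ENNReal.ofReal_rpow_of_pos hw] at h1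
    rw [Real.rpow_neg ht.le, ← div_eq_mul_inv, ENNReal.ofReal_div_of_pos (by positivity)]
    rw [ENNReal.le_div_iff_mul_le (Or.inl (by simp; positivity)) (Or.inl ENNReal.ofReal_ne_top),
      mul_comm]
    exact h1
  have hfin : ∀ᵐ x ∂μ, G x ≠ ∞ := by
    rw [ae_iff]
    have hlim : Filter.Tendsto (fun t : ℝ => ENNReal.ofReal (w ^ q * t ^ (-q))) Filter.atTop
        (nhds 0) := by
      have := ((tendsto_rpow_neg_atTop hq0).const_mul (w ^ q))
      rw [mul_zero] at this
      simpa using ENNReal.tendsto_ofReal this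
    refine le_antisymm (ge_of_tendsto hlim ?_) zero_le
    filter_upwards [Filter.eventually_gt_atTop 0] with t ht
    refine le_trans (measure_mono fun x hx => ?_) (hdist t ht)
    simp only [ne_eq, not_not, mem_ofPred_eq] at hx
    simp [hx]
  set m : ℝ := (μ univ).toReal with hm
  have hm0 : 0 < m := ENNReal.toReal_pos (by simpa using hμ) (measure_ne_top _ _)
  have hmu : μ univ = ENNReal.ofReal m := (ENNReal.ofReal_toReal (measure_ne_top _ _)).symm
  set t₀ : ℝ := w * m ^ (-(1 / q)) with ht₀
  have ht₀0 : 0 < t₀ := by positivity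
  have hcake : ∫⁻ x, G x ∂μ = ∫⁻ t in Ioi (0 : ℝ), μ {x | t < (G x).toReal} := by
    rw [← lintegral_eq_lintegral_meas_lt μ (Filter.Eventually.of_forall fun x => toReal_nonneg)
      hG.ennreal_toReal.aemeasurable]
    refine lintegral_congr_ae ?_
    filter_upwards [hfin] with x hx
    exact (ENNReal.ofReal_toReal hx).symm
  have hsub : ∀ t : ℝ, 0 < t → μ {x | t < (G x).toReal} ≤ ENNReal.ofReal (w ^ q * t ^ (-q)) := by
    intro t ht
    refine le_trans (measure_mono fun x hx => ?_) (hdist t ht)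
    exact (ENNReal.ofReal_lt_iff_lt_toReal ht.le (fun hx' => by
      simp [hx'] at hx; linarith)).2 hx
  rw [hcake, ← Ioc_union_Ioi_eq_Ioi ht₀0.le,
    lintegral_union measurableSet_Ioi (Ioc_disjoint_Ioi le_rfl)]
  have h1 : ∫⁻ t in Ioc 0 t₀, μ {x | t < (G x).toReal} ≤ ENNReal.ofReal (m * t₀) := by
    calc _ ≤ ∫⁻ t in Ioc 0 t₀, μ univ := lintegral_mono fun t => measure_mono (subset_univ _)
      _ = _ := by
        rw [setLIntegral_const, hmu, Real.volume_Ioc, sub_zero, ENNReal.ofReal_mul hm0.le]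
  have h2 : ∫⁻ t in Ioi t₀, μ {x | t < (G x).toReal} ≤
      ENNReal.ofReal (w ^ q * (-t₀ ^ (-q + 1) / (-q + 1))) := by
    calc _ ≤ ∫⁻ t in Ioi t₀, ENNReal.ofReal (w ^ q * t ^ (-q)) :=
          setLIntegral_mono' measurableSet_Ioi fun t ht => hsub t (ht₀0.trans ht)
      _ = _ := by
        rw [← ofReal_integral_eq_lintegral_ofReal, integral_const_mul,
          integral_Ioi_rpow_of_lt (by linarith) ht₀0]
        · exact (integrableOn_Ioi_rpow_of_lt (by linarith) ht₀0).const_mul _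
        · filter_upwards [ae_restrict_mem measurableSet_Ioi] with t ht
          have : 0 < t := ht₀0.trans ht
          simp only [Pi.zero_apply]
          positivity
  refine (add_le_add h1 h2).trans (le_of_eq ?_)
  have hq1 : 0 < q - 1 := by linarith
  have hcq : 0 < conjExp q := div_pos hq0 hq1
  have e1 : m * t₀ = w * m ^ (1 / conjExp q) := by
    have : 1 / conjExp q = 1 + -(1 / q) := by unfold conjExp; field_simp; ring
    rw [this, Real.rpow_add hm0, Real.rpow_one, ht₀]; ring
  have e2 : w ^ q * t₀ ^ (-q + 1) = w * m ^ (1 / conjExp q) := by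
    have : 1 / conjExp q = -(1 / q) * (-q + 1) := by unfold conjExp; field_simp; ring
    rw [ht₀, Real.mul_rpow hw.le (by positivity), ← Real.rpow_mul hm0.le, this, ← mul_assoc,
      ← Real.rpow_add hw]
    simp
  rw [hmu, ENNReal.ofReal_rpow_of_pos hm0, ← ENNReal.ofReal_mul hcq.le,
    ← ENNReal.ofReal_mul (by positivity), ← ENNReal.ofReal_add (by positivity)]
  · congr 1
    have e3 : w ^ q * (-t₀ ^ (-q + 1) / (-q + 1)) = w * m ^ (1 / conjExp q) / (q - 1) := by
      rw [← e2, show -q + 1 = -(q - 1) by ring, neg_div_neg_eq, mul_div_assoc]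
    rw [e1, e3]
    have : conjExp q = 1 + 1 / (q - 1) := by unfold conjExp; field_simp; ring
    rw [this]; ring
  · rw [show -q + 1 = -(q - 1) by ring, neg_div_neg_eq]
    positivity

lemma Cube.set_eq_pi {n : ℕ} (Q : Cube n) :
    Q.set = univ.pi fun i => Ico (Q.corner i) (Q.corner i + Q.side) := by
  ext x; simp [Cube.set]

lemma IsWeight.lintegral_cube_lt_top {n : ℕ} {w : Rn n → ℝ} (hw : IsWeight w) (Q : Cube n) :
    ∫⁻ x in Q.set, ENNReal.ofReal (w x) < ∞ := by
  have hsub : Q.set ⊆ Icc Q.corner fun i => Q.corner i + Q.side := fun x hx =>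
    ⟨fun i => (hx i).1, fun i => (hx i).2.le⟩
  have hint : IntegrableOn w Q.set :=
    (hw.2.2.integrableOn_isCompact isCompact_Icc).mono_set hsub
  exact hint.lintegral_lt_top

lemma eucNorm_sub_comm {n : ℕ} (x y : Rn n) : eucNorm (x - y) = eucNorm (y - x) := by
  unfold eucNorm
  congr 1
  exact Finset.sum_congr rfl fun i _ => by simp only [Pi.sub_apply]; ring

lemma continuous_eucNorm {n : ℕ} : Continuous (eucNorm : Rn n → ℝ) := by
  unfold eucNorm; fun_prop

lemma eucNorm_pos {n : ℕ} {x : Rn n} (hx : x ≠ 0) : 0 < eucNorm x := by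
  obtain ⟨i, hi⟩ := Function.ne_iff.1 hx
  exact Real.sqrt_pos.2 (Finset.sum_pos' (fun j _ => sq_nonneg _)
    ⟨i, Finset.mem_univ i, by have : x i ≠ 0 := hi; positivity⟩)

lemma Cube.eucNorm_sub_le {n : ℕ} (Q : Cube n) {x y : Rn n} (hx : x ∈ Q.set) (hy : y ∈ Q.set) :
    eucNorm (x - y) ≤ Real.sqrt n * Q.side := by
  have hs := Q.side_pos
  unfold eucNorm
  rw [← Real.sqrt_sq hs.le, ← Real.sqrt_mul (by positivity)]
  refine Real.sqrt_le_sqrt ?_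
  calc ∑ i, (x - y) i ^ 2 ≤ ∑ _i : Fin n, Q.side ^ 2 := by
        refine Finset.sum_le_sum fun i _ => ?_
        have h1 := hx i
        have h2 := hy i
        simp only [Pi.sub_apply]
        exact sq_le_sq' (by linarith) (by linarith)
    _ = _ := by simp

lemma measurable_rieszKernel {n : ℕ} (α : ℝ) :
    Measurable fun z : Rn n × Rn n => ENNReal.ofReal (eucNorm (z.1 - z.2) ^ (α - n)) :=
  ENNReal.measurable_ofReal.comp
    ((continuous_eucNorm.comp (continuous_fst.sub continuous_snd)).measurable.pow_const _)

lemma measurable_riesz {n : ℕ} (α : ℝ) {f : Rn n → ℝ≥0∞} (hf : Measurable f) :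
    Measurable (riesz α f) :=
  Measurable.lintegral_prod_right'
    (f := fun z : Rn n × Rn n => f z.2 * ENNReal.ofReal (eucNorm (z.1 - z.2) ^ (α - n)))
    ((hf.comp measurable_snd).mul (measurable_rieszKernel α))

/-- The Riesz potential is self-adjoint. -/
lemma lintegral_riesz_mul {n : ℕ} (α : ℝ) {f g : Rn n → ℝ≥0∞} (hf : Measurable f)
    (hg : Measurable g) :
    ∫⁻ x, riesz α f x * g x = ∫⁻ y, f y * riesz α g y := by
  have hk : ∀ x : Rn n, Measurable fun y => ENNReal.ofReal (eucNorm (x - y) ^ (α - n)) :=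
    fun x => ENNReal.measurable_ofReal.comp
      ((continuous_eucNorm.comp (continuous_const.sub continuous_id)).measurable.pow_const _)
  have hf2 : Measurable fun z : Rn n × Rn n => f z.2 := hf.comp measurable_snd
  have hg1 : Measurable fun z : Rn n × Rn n => g z.1 := hg.comp measurable_fst
  have hm : Measurable fun z : Rn n × Rn n =>
      f z.2 * ENNReal.ofReal (eucNorm (z.1 - z.2) ^ (α - n)) * g z.1 :=
    (hf2.mul (measurable_rieszKernel α)).mul hg1
  have hleft : ∀ x, riesz α f x * g x =
      ∫⁻ y, f y * ENNReal.ofReal (eucNorm (x - y) ^ (α - n)) * g x := fun x =>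
    (lintegral_mul_const (g x) (hf.mul (hk x))).symm
  have hright : ∀ y, f y * riesz α g y =
      ∫⁻ x, f y * ENNReal.ofReal (eucNorm (x - y) ^ (α - n)) * g x := fun y => by
    refine (lintegral_const_mul (f y) (hg.mul (hk y))).symm.trans ?_
    refine lintegral_congr fun x => ?_
    rw [Pi.mul_apply, eucNorm_sub_comm x y, mul_assoc, mul_comm (g x)]
  simp_rw [hleft, hright]
  exact lintegral_lintegral_swap hm.aemeasurable

/-- The fractional maximal function is dominated pointwise by the Riesz potential. -/
lemma fracMax_le_riesz {n : ℕ} (hn : 0 < n) {α : ℝ} (hαn : α < n) (f : Rn n → ℝ≥0∞)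
    (x : Rn n) :
    fracMax α f x ≤ ENNReal.ofReal (Real.sqrt n ^ (n - α)) * riesz α f x := by
  have : Nonempty (Fin n) := ⟨⟨0, hn⟩⟩
  have hn' : (0 : ℝ) < n := Nat.cast_pos.2 hn
  refine iSup₂_le fun Q hx => ?_
  have hs := Q.side_pos
  rw [riesz, ← lintegral_const_mul' _ _ ENNReal.ofReal_ne_top,
    ← lintegral_const_mul' _ _ ENNReal.ofReal_ne_top]
  refine le_trans ?_ (setLIntegral_le_lintegral Q.set _)
  refine lintegral_mono_ae ?_
  have hne : ∀ᵐ y ∂(volume.restrict Q.set), y ≠ x :=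
    ae_restrict_of_ae (compl_mem_ae_iff.2 (measure_singleton x))
  filter_upwards [hne, ae_restrict_mem Q.measurableSet_set] with y hyx hy
  rw [mul_comm (f y), ← mul_assoc, ← ENNReal.ofReal_mul (by positivity)]
  gcongr
  have hpos : 0 < eucNorm (x - y) := eucNorm_pos (sub_ne_zero.2 hyx.symm)
  calc Q.vol ^ (α / n - 1) = Q.side ^ (α - n) := by
        rw [Cube.vol, ← Real.rpow_natCast, ← Real.rpow_mul hs.le]
        congr 1
        field_simp
    _ = Real.sqrt n ^ (n - α) * (Real.sqrt n * Q.side) ^ (α - n) := by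
        rw [Real.mul_rpow (by positivity) hs.le, ← mul_assoc, ← Real.rpow_add (by positivity)]
        simp
    _ ≤ _ := by
        have := Real.rpow_le_rpow_of_nonpos hpos (Q.eucNorm_sub_le hx hy)
          (show α - n ≤ 0 by linarith)
        gcongr

/-- Integrals over a cube are controlled by the weak-type operator norm. -/
lemma lintegral_cube_le_opNormWeak {n : ℕ}
    {T : (Rn n → ℝ≥0∞) → Rn n → ℝ≥0∞} {p q : ℝ} {σ u : Rn n → ℝ}
    (hq : 1 < q) (hu : IsWeight u) {g : Rn n → ℝ≥0∞} (hg : Measurable g)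
    (hTg : Measurable (T (mulW g σ)))
    (hg0 : LpW g p σ ≠ 0) (hgtop : LpW g p σ ≠ ∞) (hN : opNormWeak T p q σ u ≠ ∞) (Q : Cube n) :
    ∫⁻ x in Q.set, T (mulW g σ) x * ENNReal.ofReal (u x) ≤
      ENNReal.ofReal (conjExp q) * (opNormWeak T p q σ u * LpW g p σ) *
        (∫⁻ x in Q.set, ENNReal.ofReal (u x)) ^ (1 / conjExp q) := by
  have hum : Measurable fun x => ENNReal.ofReal (u x) := hu.1.ennreal_ofReal
  set G := T (mulW g σ) with hG
  set W := opNormWeak T p q σ u * LpW g p σ with hW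
  have hWtop : W ≠ ∞ := ENNReal.mul_ne_top hN hgtop
  have hweak : WeakLpW G q u ≤ W := by
    rw [hW, ← ENNReal.div_le_iff hg0 hgtop]
    exact le_iSup₂ (f := fun (f : Rn n → ℝ≥0∞) (_ : Measurable f) =>
      WeakLpW (T (mulW f σ)) q u / LpW f p σ) g hg
  set μ : Measure (Rn n) := (volume.restrict Q.set).withDensity fun x => ENNReal.ofReal (u x)
    with hμ
  have huniv : μ univ = ∫⁻ x in Q.set, ENNReal.ofReal (u x) := by
    rw [hμ, withDensity_apply _ MeasurableSet.univ, Measure.restrict_univ]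
  have hmfin : μ univ < ∞ := huniv ▸ hu.lintegral_cube_lt_top Q
  have : IsFiniteMeasure μ := ⟨hmfin⟩
  have hint : ∫⁻ x in Q.set, G x * ENNReal.ofReal (u x) = ∫⁻ x, G x ∂μ := by
    rw [hμ, lintegral_withDensity_eq_lintegral_mul _ hum hTg]
    simp [mul_comm]
  rw [hint, ← huniv]
  have key : ∀ w : ℝ, 0 < w → W ≤ ENNReal.ofReal w → ∫⁻ x, G x ∂μ ≤
      ENNReal.ofReal (conjExp q) * ENNReal.ofReal w * μ univ ^ (1 / conjExp q) := by
    intro w hw hWw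
    refine lintegral_le_of_weak_bound μ hTg hq hw fun t ht => ?_
    refine le_trans ?_ (hweak.trans hWw)
    refine le_trans ?_ (le_iSup₂ (f := fun (t : ℝ) (_ : 0 < t) => ENNReal.ofReal t *
      (∫⁻ x in {x | ENNReal.ofReal t < G x}, ENNReal.ofReal (u x)) ^ (1 / q)) t ht)
    gcongr
    rw [hμ, withDensity_apply _ (measurableSet_lt measurable_const hTg)]
    exact lintegral_mono' (Measure.restrict_mono_measure Measure.restrict_le_self _) le_rfl
  have hlim : Filter.Tendsto (fun ε : ℝ => ENNReal.ofReal (conjExp q) *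
      ENNReal.ofReal (W.toReal + ε) * μ univ ^ (1 / conjExp q)) (nhdsWithin 0 (Ioi 0))
      (nhds (ENNReal.ofReal (conjExp q) * W * μ univ ^ (1 / conjExp q))) := by
    have hcont : Filter.Tendsto (fun ε : ℝ => ENNReal.ofReal (W.toReal + ε))
        (nhdsWithin 0 (Ioi 0)) (nhds W) := by
      have : Continuous fun ε : ℝ => ENNReal.ofReal (W.toReal + ε) :=
        ENNReal.continuous_ofReal.comp (continuous_const.add continuous_id)
      have h0 := (this.tendsto 0).mono_left (nhdsWithin_le_nhds (s := Ioi 0))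
      simpa [ENNReal.ofReal_toReal hWtop] using h0
    have hcq : 0 ≤ 1 / conjExp q := by
      have : 0 < q - 1 := by linarith
      unfold conjExp; positivity
    refine ENNReal.Tendsto.mul_const (ENNReal.Tendsto.const_mul hcont
      (Or.inr ENNReal.ofReal_ne_top)) (Or.inr ?_)
    exact ENNReal.rpow_ne_top_of_nonneg hcq hmfin.ne
  refine ge_of_tendsto hlim ?_
  filter_upwards [self_mem_nhdsWithin] with ε hε
  have hε : 0 < ε := hε
  refine key _ (by positivity) ?_
  calc W = ENNReal.ofReal W.toReal := (ENNReal.ofReal_toReal hWtop).symm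
    _ ≤ _ := ENNReal.ofReal_le_ofReal (by linarith)

/-- Dual form of the weak-type bound for the Riesz potential, tested on a cube. -/
lemma riesz_testing_le {n : ℕ} {α p q : ℝ} (hp : 1 < p) (hq : 1 < q) {u σ : Rn n → ℝ}
    (hu : IsWeight u) (hσ : IsWeight σ) (hN : opNormWeak (riesz α) p q σ u ≠ ∞) (Q : Cube n) :
    (∫⁻ x in Q.set, riesz α (Q.set.indicator fun y => ENNReal.ofReal (u y)) x ^ conjExp p *
        ENNReal.ofReal (σ x)) ^ (1 / conjExp p) ≤
      ENNReal.ofReal (conjExp q) * opNormWeak (riesz α) p q σ u *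
        (∫⁻ x in Q.set, ENNReal.ofReal (u x)) ^ (1 / conjExp q) := by
  have hp1 : 0 < p - 1 := by linarith
  have hp0 : 0 < p := by linarith
  have hcp : 0 < conjExp p := div_pos hp0 hp1
  have hcp1 : 0 < conjExp p - 1 := by
    have : conjExp p - 1 = 1 / (p - 1) := by unfold conjExp; field_simp; ring
    rw [this]; positivity
  have hum : Measurable fun x => ENNReal.ofReal (u x) := hu.1.ennreal_ofReal
  have hsm : Measurable fun x => ENNReal.ofReal (σ x) := hσ.1.ennreal_ofReal
  have hQ := Q.measurableSet_set
  set v : Rn n → ℝ≥0∞ := Q.set.indicator fun y => ENNReal.ofReal (u y) with hv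
  have hvm : Measurable v := hum.indicator hQ
  set F := riesz α v with hF
  have hFm : Measurable F := measurable_riesz α hvm
  set R := ENNReal.ofReal (conjExp q) * opNormWeak (riesz α) p q σ u *
    (∫⁻ x in Q.set, ENNReal.ofReal (u x)) ^ (1 / conjExp q) with hR
  set H : ℕ → Rn n → ℝ≥0∞ := fun k x => min (F x) k with hH
  have hHm : ∀ k, Measurable (H k) := fun k => hFm.min measurable_const
  have hbound : ∀ k : ℕ, ∫⁻ x in Q.set, H k x ^ conjExp p * ENNReal.ofReal (σ x) ≤
      R ^ conjExp p := by
    intro k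
    set A := ∫⁻ x in Q.set, H k x ^ conjExp p * ENNReal.ofReal (σ x) with hA
    have hAtop : A ≠ ∞ := by
      have : A ≤ ∫⁻ x in Q.set, (k : ℝ≥0∞) ^ conjExp p * ENNReal.ofReal (σ x) :=
        lintegral_mono fun x => by gcongr; exact min_le_right _ _
      rw [lintegral_const_mul _ hsm] at this
      exact ne_top_of_le_ne_top (ENNReal.mul_ne_top
        (ENNReal.rpow_ne_top_of_nonneg hcp.le (ENNReal.natCast_ne_top k))
        (hσ.lintegral_cube_lt_top Q).ne) this
    rcases eq_or_ne A 0 with hA0 | hA0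
    · rw [hA0]; exact zero_le
    set g : Rn n → ℝ≥0∞ := Q.set.indicator fun x => H k x ^ (conjExp p - 1) with hg
    have hgm : Measurable g := ((hHm k).pow_const _).indicator hQ
    have hgnorm : LpW g p σ = A ^ (1 / p) := by
      rw [LpW, hA, ← lintegral_indicator hQ]
      congr 1
      refine lintegral_congr fun x => ?_
      by_cases hx : x ∈ Q.set
      · simp only [hg, indicator_of_mem hx]
        rw [← ENNReal.rpow_mul]
        congr 2
        unfold conjExp; field_simp; ring
      · simp [hg, indicator_of_notMem hx, hp0]
    have hdual : A ≤ ∫⁻ x in Q.set, riesz α (mulW g σ) x * ENNReal.ofReal (u x) := by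
      have e1 : ∫⁻ x in Q.set, riesz α (mulW g σ) x * ENNReal.ofReal (u x) =
          ∫⁻ x, riesz α (mulW g σ) x * v x := by
        rw [← lintegral_indicator hQ]
        refine lintegral_congr fun x => ?_
        by_cases hx : x ∈ Q.set <;> simp [hv, hx]
      have e2 : ∫⁻ x, riesz α (mulW g σ) x * v x = ∫⁻ x, mulW g σ x * F x :=
        lintegral_riesz_mul α (hgm.mul hsm) hvm
      rw [e1, e2, hA, ← lintegral_indicator hQ]
      refine lintegral_mono fun x => ?_
      by_cases hx : x ∈ Q.set
      · simp only [indicator_of_mem hx, mulW, hg]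
        have hpow : H k x ^ conjExp p = H k x ^ (conjExp p - 1) * H k x := by
          conv_lhs => rw [show conjExp p = (conjExp p - 1) + 1 by ring]
          rw [ENNReal.rpow_add_of_nonneg _ _ hcp1.le zero_le_one, ENNReal.rpow_one]
        rw [hpow, mul_right_comm]
        gcongr
        exact min_le_left _ _
      · simp [indicator_of_notMem hx]
    have hApow0 : A ^ (1 / p) ≠ 0 := by
      rw [Ne, ENNReal.rpow_eq_zero_iff]; simp [hA0, hAtop]
    have hApowtop : A ^ (1 / p) ≠ ∞ := ENNReal.rpow_ne_top_of_nonneg (by positivity) hAtop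
    have hmain : A ≤ R * A ^ (1 / p) := by
      refine hdual.trans ((lintegral_cube_le_opNormWeak hq hu hgm
        (measurable_riesz α (hgm.mul hsm)) (hgnorm ▸ hApow0) (hgnorm ▸ hApowtop) hN Q).trans
        (le_of_eq ?_))
      rw [hgnorm, hR]; ring
    have hroot : A ^ (1 / conjExp p) ≤ R := by
      have hsplit : A = A ^ (1 / conjExp p) * A ^ (1 / p) := by
        rw [← ENNReal.rpow_add _ _ hA0 hAtop]
        have : 1 / conjExp p + 1 / p = 1 := by unfold conjExp; field_simp; ring
        rw [this, ENNReal.rpow_one]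
      refine (ENNReal.mul_le_mul_iff_left hApow0 hApowtop).1 ?_
      rwa [← hsplit]
    calc A = (A ^ (1 / conjExp p)) ^ conjExp p := by
          rw [← ENNReal.rpow_mul, one_div_mul_cancel hcp.ne', ENNReal.rpow_one]
      _ ≤ _ := ENNReal.rpow_le_rpow hroot hcp.le
  have hsup : ∫⁻ x in Q.set, F x ^ conjExp p * ENNReal.ofReal (σ x) =
      ⨆ k, ∫⁻ x in Q.set, H k x ^ conjExp p * ENNReal.ofReal (σ x) := by
    rw [← lintegral_iSup]
    · refine lintegral_congr fun x => ?_
      rw [← ENNReal.iSup_mul]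
      congr 1
      have h1 : F x = ⨆ k, H k x := by
        simp only [hH]
        rw [← inf_iSup_eq, ENNReal.iSup_natCast, inf_top_eq]
      rw [h1]
      exact (ENNReal.orderIsoRpow (conjExp p) hcp).map_iSup _
    · exact fun k => ((hHm k).pow_const _).mul hsm
    · intro k l hkl x
      have : (k : ℝ≥0∞) ≤ l := by exact_mod_cast hkl
      simp only [hH]
      gcongr
  rw [hsup]
  calc _ ≤ (R ^ conjExp p) ^ (1 / conjExp p) :=
        ENNReal.rpow_le_rpow (iSup_le hbound) (by positivity)
    _ = R := by rw [← ENNReal.rpow_mul, mul_one_div_cancel hcp.ne', ENNReal.rpow_one]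

/-- Sawyer testing constant bounded by the weak norm of the Riesz
potential: `[σ,u]_{M_α,q',p'} ≤ C ‖I_α(·σ)‖_{L^p(σ)→L^{q,∞}(u)}`. -/
theorem stmt15 (n : ℕ) (hn : 0 < n) (α p q : ℝ) (hα : 0 < α) (hαn : α < n)
    (hp : 1 < p) (hpq : p < q) :
    ∃ C : ℝ≥0∞, 0 < C ∧ C < ∞ ∧
      ∀ u σ : Rn n → ℝ, IsWeight u → IsWeight σ →
        (⨆ Q : Cube n,
            (∫⁻ x in Q.set,
                fracMax α (Q.set.indicator fun y => ENNReal.ofReal (u y)) x ^ conjExp p *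
                  ENNReal.ofReal (σ x)) ^ (1 / conjExp p) /
              (∫⁻ x in Q.set, ENNReal.ofReal (u x)) ^ (1 / conjExp q)) ≤
          C * opNormWeak (riesz α) p q σ u := by
  have hq : 1 < q := hp.trans hpq
  have hcp : 0 < conjExp p := div_pos (by linarith) (by linarith)
  have hcq : 0 < conjExp q := div_pos (by linarith) (by linarith)
  set c : ℝ := Real.sqrt n ^ (n - α) with hc
  have hc0 : 0 < c := by positivity
  have hC0 : 0 < ENNReal.ofReal c * ENNReal.ofReal (conjExp q) :=
    ENNReal.mul_pos (by simpa using hc0) (by simpa using hcq)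
  refine ⟨ENNReal.ofReal c * ENNReal.ofReal (conjExp q), hC0,
    ENNReal.mul_lt_top ENNReal.ofReal_lt_top ENNReal.ofReal_lt_top, ?_⟩
  intro u σ hu hσ
  rcases eq_or_ne (opNormWeak (riesz α) p q σ u) ∞ with hN | hN
  · rw [hN, ENNReal.mul_top hC0.ne']
    exact le_top
  refine iSup_le fun Q => ENNReal.div_le_of_le_mul ?_
  have hscale := lintegral_mono (μ := volume.restrict Q.set) fun x =>
    mul_le_mul_left (ENNReal.rpow_le_rpow (fracMax_le_riesz hn hαn
      (Q.set.indicator fun y => ENNReal.ofReal (u y)) x) hcp.le) (ENNReal.ofReal (σ x))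
  simp_rw [ENNReal.mul_rpow_of_nonneg _ _ hcp.le, mul_assoc] at hscale
  rw [lintegral_const_mul' _ _ (ENNReal.rpow_ne_top_of_nonneg hcp.le ENNReal.ofReal_ne_top)]
    at hscale
  refine (ENNReal.rpow_le_rpow hscale (by positivity)).trans ?_
  rw [ENNReal.mul_rpow_of_nonneg _ _ (by positivity), ← ENNReal.rpow_mul,
    mul_one_div_cancel hcp.ne', ENNReal.rpow_one, mul_assoc, mul_assoc]
  gcongr
  rw [← mul_assoc]
  exact riesz_testing_le hp hq hu hσ hN Q
end
end

section
/- Let 0≤α<n and let 𝒟 be a dyadic grid in ℝ^n. For every nonnegative bounded compactly supported function f there exists a sparse family 𝒮⊂𝒟, with associated pairwise disjoint sets {E_Q}_{Q∈𝒮}, such that for almost every x∈ℝ^n, M_α^𝒟 f(x) ≤ C·L_α^𝒮 f(x), where C depends only on n and α (not on 𝒟, 𝒮 or f). -/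
open MeasureTheory ENNReal Set

noncomputable section

namespace Cube

variable {n : ℕ}

lemma vol_pos (Q : Cube n) : 0 < Q.vol := pow_pos Q.side_pos n

lemma set_eq_pi_s16 (Q : Cube n) :
    Q.set = Set.univ.pi fun i => Ico (Q.corner i) (Q.corner i + Q.side) := by
  ext x
  simp [Cube.set]

lemma measurableSet_set_s16 (Q : Cube n) : MeasurableSet Q.set := by
  rw [set_eq_pi_s16]
  exact MeasurableSet.univ_pi fun _ => measurableSet_Ico

lemma volume_set (Q : Cube n) : volume Q.set = ENNReal.ofReal Q.vol := by
  rw [set_eq_pi_s16, volume_pi_pi]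
  simp [Real.volume_Ico, Cube.vol, ENNReal.ofReal_pow Q.side_pos.le]

lemma corner_mem (Q : Cube n) : Q.corner ∈ Q.set := fun _ =>
  ⟨le_rfl, lt_add_of_pos_right _ Q.side_pos⟩

lemma vol_le_of_subset {Q P : Cube n} (h : Q.set ⊆ P.set) : Q.vol ≤ P.vol := by
  have := measure_mono (μ := volume) h
  rwa [volume_set, volume_set, ENNReal.ofReal_le_ofReal_iff P.vol_pos.le] at this

lemma side_le_of_subset_s16 (hn : 0 < n) {Q P : Cube n} (h : Q.set ⊆ P.set) : Q.side ≤ P.side :=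
  (pow_le_pow_iff_left₀ Q.side_pos.le P.side_pos.le hn.ne').1 (vol_le_of_subset h)

/-- The quantity `|Q|^{α/n-1} ∫_Q f`. -/
def fracAvg (α : ℝ) (f : Rn n → ℝ≥0∞) (Q : Cube n) : ℝ≥0∞ :=
  ENNReal.ofReal (Q.vol ^ (α / n - 1)) * ∫⁻ y in Q.set, f y

lemma vol_mul_fracAvg (α : ℝ) (f : Rn n → ℝ≥0∞) (Q : Cube n) :
    ENNReal.ofReal Q.vol * Q.fracAvg α f =
      ENNReal.ofReal (Q.vol ^ (α / n)) * ∫⁻ y in Q.set, f y := by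
  rw [fracAvg, ← mul_assoc, ← ENNReal.ofReal_mul Q.vol_pos.le,
    Real.rpow_sub_one Q.vol_pos.ne', mul_div_cancel₀ _ Q.vol_pos.ne']

lemma fracAvg_le_two_pow_mul {α : ℝ} (hα : 0 ≤ α) (f : Rn n → ℝ≥0∞) {Q P : Cube n}
    (hQP : Q.set ⊆ P.set) (hside : P.side = 2 * Q.side) :
    Q.fracAvg α f ≤ 2 ^ n * P.fracAvg α f := by
  have hvol : P.vol = 2 ^ n * Q.vol := by simp [Cube.vol, hside, mul_pow]
  have hpow : Q.vol ^ (α / n - 1) ≤ 2 ^ n * P.vol ^ (α / n - 1) := by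
    have h : Q.vol ^ (α / n) ≤ P.vol ^ (α / n) :=
      Real.rpow_le_rpow Q.vol_pos.le (vol_le_of_subset hQP) (by positivity)
    rw [Real.rpow_sub_one Q.vol_pos.ne', Real.rpow_sub_one P.vol_pos.ne', mul_div_assoc']
    rw [div_le_div_iff₀ Q.vol_pos P.vol_pos]
    calc Q.vol ^ (α / n) * P.vol ≤ P.vol ^ (α / n) * P.vol :=
          mul_le_mul_of_nonneg_right h P.vol_pos.le
      _ = _ := by nth_rewrite 2 [hvol]; ring
  calc Q.fracAvg α f
      ≤ ENNReal.ofReal (2 ^ n * P.vol ^ (α / n - 1)) * ∫⁻ y in P.set, f y :=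
        mul_le_mul' (ENNReal.ofReal_le_ofReal hpow) (lintegral_mono_set hQP)
    _ = 2 ^ n * P.fracAvg α f := by
        rw [ENNReal.ofReal_mul (by positivity), mul_assoc, fracAvg,
          ENNReal.ofReal_pow (by norm_num)]
        simp

lemma fracAvg_le_max {α : ℝ} (hα : 0 ≤ α) (hαn : α < n) {f : Rn n → ℝ≥0∞} {M : ℝ≥0∞}
    (hM : ∀ x, f x ≤ M) (Q : Cube n) : Q.fracAvg α f ≤ max M (∫⁻ y, f y) := by
  have hn : (0 : ℝ) < n := hα.trans_lt hαn
  rcases le_total Q.vol 1 with h | h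
  · refine le_max_of_le_left ?_
    have hint : ∫⁻ y in Q.set, f y ≤ M * ENNReal.ofReal Q.vol := by
      calc ∫⁻ y in Q.set, f y ≤ ∫⁻ _ in Q.set, M := lintegral_mono hM
        _ = M * ENNReal.ofReal Q.vol := by rw [setLIntegral_const, volume_set]
    calc Q.fracAvg α f
        ≤ ENNReal.ofReal (Q.vol ^ (α / n - 1)) * (M * ENNReal.ofReal Q.vol) := by
          unfold fracAvg; gcongr
      _ = M * ENNReal.ofReal (Q.vol ^ (α / n)) := by
          rw [mul_left_comm, ← ENNReal.ofReal_mul (Real.rpow_nonneg Q.vol_pos.le _),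
            Real.rpow_sub_one Q.vol_pos.ne', div_mul_cancel₀ _ Q.vol_pos.ne']
      _ ≤ M * 1 := by
          gcongr
          exact ENNReal.ofReal_le_one.2 (Real.rpow_le_one Q.vol_pos.le h (by positivity))
      _ = M := mul_one M
  · refine le_max_of_le_right ?_
    calc Q.fracAvg α f ≤ 1 * ∫⁻ y, f y := by
          refine mul_le_mul' (ENNReal.ofReal_le_one.2 ?_) (setLIntegral_le_lintegral _ _)
          refine Real.rpow_le_one_of_one_le_of_nonpos h ?_
          rw [sub_nonpos, div_le_one hn]
          exact hαn.le
      _ = _ := one_mul _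

/-- The averages `|Q|^{α/n-1} ∫_Q f` are small on large cubes. -/
lemma exists_forall_fracAvg_le {α : ℝ} (hα : 0 ≤ α) (hαn : α < n) {f : Rn n → ℝ≥0∞}
    (hf : ∫⁻ y, f y ≠ ∞) {t : ℝ≥0∞} (ht : 0 < t) :
    ∃ v : ℝ, ∀ Q : Cube n, v ≤ Q.vol → Q.fracAvg α f ≤ t := by
  have hn : (0 : ℝ) < n := hα.trans_lt hαn
  have hexp : 0 < 1 - α / n := by
    rw [sub_pos, div_lt_one hn]
    exact hαn
  have hlim : Filter.Tendsto
      (fun v : ℝ => ENNReal.ofReal (v ^ (α / n - 1)) * ∫⁻ y, f y) Filter.atTop (nhds 0) := by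
    have h := ENNReal.Tendsto.mul_const (b := ∫⁻ y, f y)
      (ENNReal.tendsto_ofReal (tendsto_rpow_neg_atTop hexp)) (Or.inr hf)
    simpa using h
  obtain ⟨v, hv⟩ := Filter.eventually_atTop.1 (hlim.eventually_le_const ht)
  refine ⟨v, fun Q hQ => le_trans ?_ (hv _ hQ)⟩
  exact mul_le_mul_right (setLIntegral_le_lintegral _ _) _

end Cube

namespace IsDyadicGrid

variable {n : ℕ} {D : Set (Cube n)}

lemma eq_of_side_eq_s16 (hD : IsDyadicGrid D) {Q P : Cube n} (hQ : Q ∈ D) (hP : P ∈ D)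
    (hs : Q.side = P.side) {x : Rn n} (hxQ : x ∈ Q.set) (hxP : x ∈ P.set) : Q = P := by
  obtain ⟨k, hk⟩ := hD.1 Q hQ
  exact (hD.2.2 k x).unique ⟨hQ, hk, hxQ⟩ ⟨hP, hs ▸ hk, hxP⟩

lemma subset_or_subset (hD : IsDyadicGrid D) {Q P : Cube n} (hQ : Q ∈ D) (hP : P ∈ D)
    {x : Rn n} (hxQ : x ∈ Q.set) (hxP : x ∈ P.set) : Q.set ⊆ P.set ∨ P.set ⊆ Q.set := by
  rcases hD.2.1 Q hQ P hP with h | h | h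
  · exact Or.inr (inter_eq_right.1 h)
  · exact Or.inl (inter_eq_left.1 h)
  · exact ((h ▸ ⟨hxQ, hxP⟩ : x ∈ (∅ : Set (Rn n)))).elim

lemma exists_parent (hn : 0 < n) (hD : IsDyadicGrid D) {Q : Cube n} (hQ : Q ∈ D) :
    ∃ P ∈ D, Q.set ⊆ P.set ∧ P.side = 2 * Q.side := by
  obtain ⟨k, hk⟩ := hD.1 Q hQ
  obtain ⟨P, ⟨hP, hPk, hmem⟩, -⟩ := hD.2.2 (k + 1) Q.corner
  have hside : P.side = 2 * Q.side := by
    rw [hPk, hk, zpow_add_one₀ two_ne_zero, mul_comm]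
  refine ⟨P, hP, (hD.subset_or_subset hQ hP Q.corner_mem hmem).resolve_right fun h => ?_, hside⟩
  have := Cube.side_le_of_subset_s16 hn h
  linarith [Q.side_pos]

lemma countable (hD : IsDyadicGrid D) : D.Countable := by
  have hlevel : ∀ k : ℤ, {Q ∈ D | Q.side = (2 : ℝ) ^ k}.Countable := by
    intro k
    have := Measure.countable_meas_pos_of_disjoint_iUnion (μ := (volume : Measure (Rn n)))
      (As := fun Q : {Q // Q ∈ D ∧ Q.side = (2 : ℝ) ^ k} => Q.1.set)
      (fun Q => Q.1.measurableSet_set_s16) (fun Q P hne => by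
        refine Set.disjoint_left.2 fun x hxQ hxP => hne (Subtype.ext ?_)
        exact hD.eq_of_side_eq_s16 Q.2.1 P.2.1 (Q.2.2.trans P.2.2.symm) hxQ hxP)
    have huniv : {Q : {Q // Q ∈ D ∧ Q.side = (2 : ℝ) ^ k} | 0 < volume Q.1.set} = univ := by
      ext Q
      simp [Cube.volume_set, Q.1.vol_pos]
    rw [huniv, countable_univ_iff] at this
    exact this.to_set
  refine (countable_iUnion hlevel).mono fun Q hQ => ?_
  obtain ⟨k, hk⟩ := hD.1 Q hQ
  exact mem_iUnion.2 ⟨k, hQ, hk⟩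

end IsDyadicGrid

section SparseDomination

variable {n : ℕ} {D : Set (Cube n)} {α : ℝ} {f : Rn n → ℝ≥0∞}

/-- The cubes of `D` that are maximal subject to `t < |Q|^{α/n-1} ∫_Q f`. -/
def stoppingCubes (D : Set (Cube n)) (α : ℝ) (f : Rn n → ℝ≥0∞) (t : ℝ≥0∞) : Set (Cube n) :=
  {Q ∈ D | t < Q.fracAvg α f ∧ ∀ P ∈ D, Q.set ⊆ P.set → P ≠ Q → P.fracAvg α f ≤ t}

/-- The superlevel set `{M_α^D f > t}`, written as a union of cubes. -/
def levelUnion (D : Set (Cube n)) (α : ℝ) (f : Rn n → ℝ≥0∞) (t : ℝ≥0∞) : Set (Rn n) :=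
  ⋃ Q ∈ {Q ∈ D | t < Q.fracAvg α f}, Q.set

lemma mem_levelUnion {t : ℝ≥0∞} {x : Rn n} :
    x ∈ levelUnion D α f t ↔ ∃ Q ∈ D, t < Q.fracAvg α f ∧ x ∈ Q.set := by
  simp [levelUnion, and_assoc]

lemma measurableSet_levelUnion (hD : IsDyadicGrid D) (t : ℝ≥0∞) :
    MeasurableSet (levelUnion D α f t) :=
  MeasurableSet.biUnion (hD.countable.mono (sep_subset _ _)) fun Q _ => Q.measurableSet_set_s16

lemma stoppingCubes_eq (hD : IsDyadicGrid D) {t : ℝ≥0∞} {Q P : Cube n}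
    (hQ : Q ∈ stoppingCubes D α f t) (hP : P ∈ stoppingCubes D α f t) {x : Rn n}
    (hxQ : x ∈ Q.set) (hxP : x ∈ P.set) : Q = P := by
  by_contra hne
  rcases hD.subset_or_subset hQ.1 hP.1 hxQ hxP with h | h
  · exact (hQ.2.2 P hP.1 h (Ne.symm hne)).not_gt hP.2.1
  · exact (hP.2.2 Q hQ.1 h hne).not_gt hQ.2.1

lemma exists_mem_stoppingCubes (hα : 0 ≤ α) (hαn : α < n) (hD : IsDyadicGrid D)
    (hf : ∫⁻ y, f y ≠ ∞) {t : ℝ≥0∞} (ht : 0 < t) {x : Rn n}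
    (hx : x ∈ levelUnion D α f t) : ∃ Q ∈ stoppingCubes D α f t, x ∈ Q.set := by
  have hn : 0 < n := by exact_mod_cast hα.trans_lt hαn
  obtain ⟨Q₀, hQ₀, htQ₀, hxQ₀⟩ := mem_levelUnion.1 hx
  obtain ⟨k₀, hk₀⟩ := hD.1 Q₀ hQ₀
  obtain ⟨v, hv⟩ := Cube.exists_forall_fracAvg_le hα hαn hf ht
  obtain ⟨N, hN⟩ := exists_nat_ge v
  have hbdd : ∀ k : ℤ, (∃ Q ∈ D, Q.side = (2 : ℝ) ^ k ∧ x ∈ Q.set ∧ t < Q.fracAvg α f) →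
      k ≤ N := by
    rintro k ⟨Q, -, hk, -, htQ⟩
    by_contra! hlt
    refine (hv Q ?_).not_gt htQ
    have h1 : (N : ℝ) ≤ Q.side := by
      rw [hk]
      calc (N : ℝ) ≤ (2 : ℝ) ^ N := by exact_mod_cast Nat.lt_two_pow_self.le
        _ = (2 : ℝ) ^ (N : ℤ) := (zpow_natCast _ _).symm
        _ ≤ (2 : ℝ) ^ k := zpow_le_zpow_right₀ one_le_two hlt.le
    have h2 : 1 ≤ Q.side := by
      rw [hk]
      exact one_le_zpow₀ one_le_two (by omega)
    exact hN.trans (h1.trans (le_self_pow₀ h2 hn.ne'))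
  obtain ⟨k, ⟨Q, hQ, hk, hxQ, htQ⟩, hmax⟩ :=
    Int.exists_greatest_of_bdd ⟨N, hbdd⟩ ⟨k₀, Q₀, hQ₀, hk₀, hxQ₀, htQ₀⟩
  refine ⟨Q, ⟨hQ, htQ, fun P hP hQP hne => ?_⟩, hxQ⟩
  by_contra! htP
  obtain ⟨j, hj⟩ := hD.1 P hP
  have hjk : j ≤ k := hmax j ⟨P, hP, hj, hQP hxQ, htP⟩
  have hside : P.side ≤ Q.side := by
    rw [hj, hk]
    exact zpow_le_zpow_right₀ one_le_two hjk
  exact hne (hD.eq_of_side_eq_s16 hP hQ (hside.antisymm (Cube.side_le_of_subset_s16 hn hQP))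
    (hQP hxQ) hxQ)

/-- Weak-type estimate inside a cube not contained in a larger cube with big average. -/
lemma mul_volume_inter_levelUnion_le (hα : 0 ≤ α) (hαn : α < n) (hD : IsDyadicGrid D)
    (hf : ∫⁻ y, f y ≠ ∞) {t : ℝ≥0∞} (ht : 0 < t) {Q : Cube n} (hQ : Q ∈ D)
    (hmax : ∀ P ∈ D, Q.set ⊆ P.set → P.fracAvg α f ≤ t) :
    t * volume (Q.set ∩ levelUnion D α f t) ≤ ENNReal.ofReal Q.vol * Q.fracAvg α f := by
  set F : Set (Cube n) := {P ∈ stoppingCubes D α f t | P.set ⊆ Q.set} with hF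
  have hFc : F.Countable := hD.countable.mono fun P hP => hP.1.1
  have hdisj : F.PairwiseDisjoint Cube.set := fun P hP R hR hne =>
    Set.disjoint_left.2 fun x hxP hxR => hne (stoppingCubes_eq hD hP.1 hR.1 hxP hxR)
  have hcover : Q.set ∩ levelUnion D α f t ⊆ ⋃ P ∈ F, P.set := by
    rintro x ⟨hxQ, hx⟩
    obtain ⟨P, hP, hxP⟩ := exists_mem_stoppingCubes hα hαn hD hf ht hx
    refine mem_biUnion (show P ∈ F from ⟨hP, ?_⟩) hxP
    exact (hD.subset_or_subset hP.1 hQ hxP hxQ).resolve_right fun h =>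
      (hmax P hP.1 h).not_gt hP.2.1
  calc t * volume (Q.set ∩ levelUnion D α f t)
      ≤ t * ∑' P : F, volume P.1.set := by
        gcongr
        exact (measure_mono hcover).trans (measure_biUnion_le volume hFc _)
    _ = ∑' P : F, t * volume P.1.set := ENNReal.tsum_mul_left.symm
    _ ≤ ∑' P : F, ENNReal.ofReal (Q.vol ^ (α / n)) * ∫⁻ y in P.1.set, f y := by
        refine ENNReal.tsum_le_tsum fun P => ?_
        calc t * volume P.1.set ≤ P.1.fracAvg α f * ENNReal.ofReal P.1.vol := by
              rw [Cube.volume_set]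
              gcongr
              exact P.2.1.2.1.le
          _ = ENNReal.ofReal (P.1.vol ^ (α / n)) * ∫⁻ y in P.1.set, f y := by
              rw [mul_comm, Cube.vol_mul_fracAvg]
          _ ≤ _ := by
              gcongr
              · exact P.1.vol_pos.le
              · exact Cube.vol_le_of_subset P.2.2
    _ = ENNReal.ofReal (Q.vol ^ (α / n)) * ∫⁻ y in ⋃ P ∈ F, P.set, f y := by
        rw [ENNReal.tsum_mul_left,
          lintegral_biUnion hFc (fun P _ => P.measurableSet_set_s16) hdisj]
    _ ≤ ENNReal.ofReal (Q.vol ^ (α / n)) * ∫⁻ y in Q.set, f y := by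
        gcongr
        exact iUnion₂_subset fun P hP => hP.2
    _ = _ := (Cube.vol_mul_fracAvg α f Q).symm

lemma fracAvg_le_dyadicFracMax {Q : Cube n} (hQ : Q ∈ D) {x : Rn n} (hx : x ∈ Q.set) :
    Q.fracAvg α f ≤ dyadicFracMax D α f x :=
  le_iSup_of_le Q (le_iSup₂_of_le hQ hx le_rfl)

lemma lt_dyadicFracMax_iff {t : ℝ≥0∞} {x : Rn n} :
    t < dyadicFracMax D α f x ↔ x ∈ levelUnion D α f t := by
  simp only [dyadicFracMax, lt_iSup_iff, mem_levelUnion, Cube.fracAvg]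
  exact exists_congr fun Q => ⟨fun ⟨h, hx, ht⟩ => ⟨h, ht, hx⟩, fun ⟨h, ht, hx⟩ => ⟨h, hx, ht⟩⟩

lemma fracAvg_le_sparseOp {S : Set (Cube n)} {E : Cube n → Set (Rn n)} {Q : Cube n}
    (hQ : Q ∈ S) {x : Rn n} (hx : x ∈ E Q) : Q.fracAvg α f ≤ sparseOp S E α f x := by
  refine le_trans (le_of_eq ?_) (ENNReal.le_tsum (⟨Q, hQ⟩ : S))
  rw [indicator_of_mem hx, Cube.fracAvg]

/-- The ratio of consecutive levels in the construction of the sparse family. -/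
def levelRatio (n : ℕ) : ℝ≥0∞ := 2 ^ (n + 1)

lemma one_lt_levelRatio (n : ℕ) : 1 < levelRatio n :=
  one_lt_pow₀ one_lt_two n.succ_ne_zero

lemma levelRatio_ne_top (n : ℕ) : levelRatio n ≠ ∞ := ENNReal.pow_ne_top (by norm_num)

/-- The stopping cubes at all levels `a ^ k`, `k ∈ ℤ`. -/
def sparseCubes (D : Set (Cube n)) (α : ℝ) (f : Rn n → ℝ≥0∞) : Set (Cube n) :=
  {Q | ∃ k : ℤ, Q ∈ stoppingCubes D α f (levelRatio n ^ k) ∧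
    Q.fracAvg α f ≤ levelRatio n ^ (k + 1)}

/-- The part of `Q` not covered by the level sets above the average of `Q`. -/
def sparseSet (D : Set (Cube n)) (α : ℝ) (f : Rn n → ℝ≥0∞) (Q : Cube n) : Set (Rn n) :=
  Q.set \ ⋃ k ∈ {k : ℤ | Q.fracAvg α f ≤ levelRatio n ^ k}, levelUnion D α f (levelRatio n ^ k)

lemma levelRatio_zpow_mono {j k : ℤ} (h : j ≤ k) : levelRatio n ^ j ≤ levelRatio n ^ k :=
  ENNReal.zpow_le_of_le (one_lt_levelRatio n).le h

lemma lt_of_levelRatio_zpow_lt {j k : ℤ} (h : levelRatio n ^ j < levelRatio n ^ k) : j < k :=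
  lt_of_not_ge fun hkj => (levelRatio_zpow_mono hkj).not_gt h

lemma levelRatio_zpow_add_one (k : ℤ) :
    levelRatio n ^ (k + 1) = levelRatio n * levelRatio n ^ k := by
  rw [ENNReal.zpow_add (zero_lt_one.trans (one_lt_levelRatio n)).ne' (levelRatio_ne_top n),
    zpow_one, mul_comm]

lemma sparseSet_eq {Q : Cube n} {k : ℤ} (h₁ : levelRatio n ^ k < Q.fracAvg α f)
    (h₂ : Q.fracAvg α f ≤ levelRatio n ^ (k + 1)) :
    sparseSet D α f Q = Q.set \ levelUnion D α f (levelRatio n ^ (k + 1)) := by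
  rw [sparseSet]
  congr 1
  refine Subset.antisymm (iUnion₂_subset fun j hj x hx => ?_)
    (subset_biUnion_of_mem (u := fun k : ℤ => levelUnion D α f (levelRatio n ^ k)) h₂)
  obtain ⟨P, hP, htP, hxP⟩ := mem_levelUnion.1 hx
  have hkj : k + 1 ≤ j := lt_of_levelRatio_zpow_lt (h₁.trans_le hj)
  exact mem_levelUnion.2 ⟨P, hP, (levelRatio_zpow_mono hkj).trans_lt htP, hxP⟩

lemma sparseSet_pairwiseDisjoint (hD : IsDyadicGrid D) :
    (sparseCubes D α f).PairwiseDisjoint (sparseSet D α f) := by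
  have key : ∀ {Q P : Cube n} {j k : ℤ}, Q ∈ stoppingCubes D α f (levelRatio n ^ j) →
      Q.fracAvg α f ≤ levelRatio n ^ (j + 1) → P ∈ stoppingCubes D α f (levelRatio n ^ k) →
      ∀ {x}, x ∈ sparseSet D α f Q → x ∈ P.set → k ≤ j := by
    intro Q P j k hQ hQj hP x hxQ hxP
    by_contra! hjk
    rw [sparseSet_eq hQ.2.1 hQj] at hxQ
    exact hxQ.2 (mem_levelUnion.2
      ⟨P, hP.1, (levelRatio_zpow_mono hjk).trans_lt hP.2.1, hxP⟩)
  rintro Q ⟨j, hQ, hQj⟩ P ⟨k, hP, hPk⟩ hne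
  refine Set.disjoint_left.2 fun x hxQ hxP => hne ?_
  obtain rfl : j = k := le_antisymm (key hP hPk hQ hxP hxQ.1) (key hQ hQj hP hxQ hxP.1)
  exact stoppingCubes_eq hD hQ hP hxQ.1 hxP.1

lemma ofReal_vol_le_two_mul_volume_sparseSet (hα : 0 ≤ α) (hαn : α < n) (hD : IsDyadicGrid D)
    (hf : ∫⁻ y, f y ≠ ∞) {Q : Cube n} (hQ : Q ∈ sparseCubes D α f) :
    ENNReal.ofReal Q.vol ≤ 2 * volume (sparseSet D α f Q) := by
  have hn : 0 < n := by exact_mod_cast hα.trans_lt hαn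
  obtain ⟨k, ⟨hQD, hkQ, hmax⟩, hQk⟩ := hQ
  have ha0 : levelRatio n ≠ 0 := (zero_lt_one.trans (one_lt_levelRatio n)).ne'
  have hpos : 0 < levelRatio n ^ (k + 1) := ENNReal.zpow_pos ha0 (levelRatio_ne_top n) _
  have htop : levelRatio n ^ (k + 1) ≠ ∞ := ENNReal.zpow_ne_top ha0 (levelRatio_ne_top n) _
  have hmax' : ∀ P ∈ D, Q.set ⊆ P.set → P.fracAvg α f ≤ levelRatio n ^ (k + 1) := by
    intro P hP hQP
    by_cases hPQ : P = Q
    · exact hPQ ▸ hQk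
    · exact (hmax P hP hQP hPQ).trans (levelRatio_zpow_mono (by omega))
  have hweak := mul_volume_inter_levelUnion_le hα hαn hD hf hpos hQD hmax'
  obtain ⟨P, hP, hQP, hside⟩ := hD.exists_parent hn hQD
  have hPQ : P ≠ Q := by
    rintro rfl
    linarith [P.side_pos]
  have hdouble : 2 * Q.fracAvg α f ≤ levelRatio n ^ (k + 1) := by
    calc 2 * Q.fracAvg α f ≤ 2 * (2 ^ n * levelRatio n ^ k) := by
          gcongr
          refine (Cube.fracAvg_le_two_pow_mul hα f hQP hside).trans ?_
          gcongr
          exact hmax P hP hQP hPQ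
      _ = levelRatio n ^ (k + 1) := by
          rw [levelRatio_zpow_add_one, ← mul_assoc, ← pow_succ', levelRatio]
  have hhalf : 2 * volume (Q.set ∩ levelUnion D α f (levelRatio n ^ (k + 1))) ≤
      ENNReal.ofReal Q.vol := by
    rw [← ENNReal.mul_le_mul_iff_right hpos.ne' htop]
    calc _ = 2 * (levelRatio n ^ (k + 1) *
            volume (Q.set ∩ levelUnion D α f (levelRatio n ^ (k + 1)))) := mul_left_comm _ _ _
      _ ≤ 2 * (ENNReal.ofReal Q.vol * Q.fracAvg α f) := by gcongr
      _ = (2 * Q.fracAvg α f) * ENNReal.ofReal Q.vol := by ring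
      _ ≤ _ := by gcongr
  rw [sparseSet_eq hkQ hQk]
  have hsplit := measure_inter_add_sdiff (μ := volume) Q.set
    (measurableSet_levelUnion (α := α) (f := f) hD (levelRatio n ^ (k + 1)))
  rw [Cube.volume_set] at hsplit
  refine (ENNReal.add_le_add_iff_left (ENNReal.ofReal_ne_top (r := Q.vol))).1 ?_
  calc ENNReal.ofReal Q.vol + ENNReal.ofReal Q.vol = 2 * ENNReal.ofReal Q.vol := (two_mul _).symm
    _ = 2 * volume (Q.set ∩ levelUnion D α f (levelRatio n ^ (k + 1))) +
          2 * volume (Q.set \ levelUnion D α f (levelRatio n ^ (k + 1))) := by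
        rw [← mul_add, hsplit]
    _ ≤ _ := by gcongr

lemma isSparse_sparseCubes (hα : 0 ≤ α) (hαn : α < n) (hD : IsDyadicGrid D)
    (hf : ∫⁻ y, f y ≠ ∞) : IsSparse D (sparseCubes D α f) (sparseSet D α f) := by
  refine ⟨fun Q ⟨_, hQ, _⟩ => hQ.1, fun Q hQ => ⟨sdiff_subset, ?_,
    ofReal_vol_le_two_mul_volume_sparseSet hα hαn hD hf hQ⟩, sparseSet_pairwiseDisjoint hD⟩
  exact Q.measurableSet_set_s16.diff
    (MeasurableSet.biUnion (to_countable _) fun k _ => measurableSet_levelUnion hD _)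

lemma dyadicFracMax_le_sparseOp (hα : 0 ≤ α) (hαn : α < n) (hD : IsDyadicGrid D)
    (hf : ∫⁻ y, f y ≠ ∞) {x : Rn n} (hx : dyadicFracMax D α f x ≠ ∞) :
    dyadicFracMax D α f x ≤
      levelRatio n * sparseOp (sparseCubes D α f) (sparseSet D α f) α f x := by
  rcases eq_or_ne (dyadicFracMax D α f x) 0 with h0 | h0
  · simp [h0]
  obtain ⟨k, hk, hk'⟩ :=
    ENNReal.exists_mem_Ioc_zpow h0 hx (one_lt_levelRatio n) (levelRatio_ne_top n)
  have ha0 : levelRatio n ≠ 0 := (zero_lt_one.trans (one_lt_levelRatio n)).ne'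
  obtain ⟨Q, hQ, hxQ⟩ := exists_mem_stoppingCubes hα hαn hD hf
    (ENNReal.zpow_pos ha0 (levelRatio_ne_top n) k) (lt_dyadicFracMax_iff.1 hk)
  have hQk := (fracAvg_le_dyadicFracMax (α := α) (f := f) hQ.1 hxQ).trans hk'
  have hxE : x ∈ sparseSet D α f Q := by
    rw [sparseSet_eq hQ.2.1 hQk]
    exact ⟨hxQ, fun h => hk'.not_gt (lt_dyadicFracMax_iff.2 h)⟩
  calc dyadicFracMax D α f x ≤ levelRatio n * levelRatio n ^ k := by
        rwa [← levelRatio_zpow_add_one]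
    _ ≤ _ := by
        gcongr
        exact hQ.2.1.le.trans
          (fracAvg_le_sparseOp (S := sparseCubes D α f) ⟨k, hQ, hQk⟩ hxE)

end SparseDomination

/-- sparse domination of the dyadic fractional maximal operator:
for every nonnegative bounded compactly supported `f` there is a sparse family
`𝒮 ⊆ 𝒟` with `M_α^𝒟 f ≤ C L_α^𝒮 f` a.e., `C = C(n,α)`. -/
theorem stmt16 (n : ℕ) (hn : 0 < n) (α : ℝ) (hα : 0 ≤ α) (hαn : α < n) :
    ∃ C : ℝ≥0∞, 0 < C ∧ C < ∞ ∧
      ∀ D : Set (Cube n), IsDyadicGrid D →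
        ∀ f : Rn n → ℝ≥0∞, Measurable f →
          (∃ M : ℝ≥0∞, M < ∞ ∧ ∀ x, f x ≤ M) →
          (∃ K : Set (Rn n), IsCompact K ∧ ∀ x ∉ K, f x = 0) →
          ∃ (S : Set (Cube n)) (E : Cube n → Set (Rn n)), IsSparse D S E ∧
            ∀ᵐ x ∂volume, dyadicFracMax D α f x ≤ C * sparseOp S E α f x := by
  refine ⟨levelRatio n, zero_lt_one.trans (one_lt_levelRatio n), (levelRatio_ne_top n).lt_top,
    fun D hD f _ ⟨M, hM, hfM⟩ ⟨K, hK, hfK⟩ => ?_⟩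
  have hf : ∫⁻ y, f y ≠ ∞ := by
    refine ne_top_of_le_ne_top (ENNReal.mul_ne_top hM.ne hK.measure_lt_top.ne)
      (?_ : _ ≤ M * volume K)
    rw [← setLIntegral_const, ← setLIntegral_eq_of_support_subset
      (s := K) (f := f) fun x hx => by_contra fun h => hx (hfK x h)]
    exact lintegral_mono hfM
  refine ⟨_, _, isSparse_sparseCubes hα hαn hD hf, Filter.Eventually.of_forall fun x =>
    dyadicFracMax_le_sparseOp hα hαn hD hf ?_⟩
  refine ne_top_of_le_ne_top (max_lt hM hf.lt_top).ne (iSup_le fun Q => iSup₂_le fun _ _ => ?_)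
  exact Cube.fracAvg_le_max hα hαn hfM Q
end
end

section
/- Let 0<α<n and 1<p≤q<∞ with 1/p−1/q ≤ α/n, and set γ = (α/n+1/q−1/p)/((1/n)(1+1/q−1/p)). Let w₁,w₂ be nonnegative locally integrable functions on ℝ^n and define u = w₁·(M_γ w₂)^{−q/p'} and σ = w₂·(M_γ w₁)^{−p'/q}. Then the pair (u,σ) satisfies [u,σ]_{A^α_{p,q}} ≤ 1. -/
open MeasureTheory ENNReal Set

noncomputable section

lemma Cube.vol_pos_s17 {n : ℕ} (Q : Cube n) : 0 < Q.vol := pow_pos Q.side_pos n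

/-- The fractional average over a cube bounds the fractional maximal function from below. -/
lemma mul_lintegral_le_fracMax {n : ℕ} (γ : ℝ) (f : Rn n → ℝ≥0∞) (Q : Cube n) {x : Rn n}
    (hx : x ∈ Q.set) :
    ENNReal.ofReal Q.vol ^ (γ / n - 1) * ∫⁻ y in Q.set, f y ≤ fracMax γ f x := by
  rw [ENNReal.ofReal_rpow_of_pos Q.vol_pos_s17]
  exact le_iSup₂_of_le (f := fun (Q : Cube n) (_ : x ∈ Q.set) =>
    ENNReal.ofReal (Q.vol ^ (γ / n - 1)) * ∫⁻ y in Q.set, f y) Q hx le_rfl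

lemma Cube.set_subset_Icc {n : ℕ} (Q : Cube n) :
    Q.set ⊆ Icc Q.corner fun i => Q.corner i + Q.side :=
  fun _ hx => ⟨fun i => (hx i).1, fun i => (hx i).2.le⟩

lemma Cube.setLIntegral_ofReal_ne_top {n : ℕ} (Q : Cube n) {w : Rn n → ℝ}
    (hw : LocallyIntegrable w volume) : ∫⁻ x in Q.set, ENNReal.ofReal (w x) ≠ ∞ :=
  ((hw.integrableOn_isCompact isCompact_Icc).mono_set Q.set_subset_Icc).lintegral_lt_top.ne

lemma avgE_mul_eq_zero {n : ℕ} (Q : Cube n) {f : Rn n → ℝ≥0∞} (g : Rn n → ℝ≥0∞)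
    (hf : Measurable f) (h : ∫⁻ x in Q.set, f x = 0) : avgE Q (fun x => f x * g x) = 0 := by
  have h0 : ∫⁻ x in Q.set, f x * g x = ∫⁻ _ in Q.set, 0 := by
    refine lintegral_congr_ae ?_
    filter_upwards [(lintegral_eq_zero_iff hf).1 h] with x hx
    simp [hx]
  simp [avgE, h0]

lemma avgE_mul_fracMax_rpow_le {n : ℕ} (γ : ℝ) {s r : ℝ} (hs : 0 ≤ s) (hr : 0 ≤ r) (Q : Cube n)
    (f g : Rn n → ℝ≥0∞) (hg : ∫⁻ x in Q.set, g x ≠ 0) (hg' : ∫⁻ x in Q.set, g x ≠ ∞) :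
    avgE Q (fun x => f x * fracMax γ g x ^ (-s)) ^ r ≤
      (∫⁻ x in Q.set, f x) ^ r * (∫⁻ x in Q.set, g x) ^ (-(s * r)) *
        ENNReal.ofReal Q.vol ^ ((1 - γ / n) * (s * r) - r) := by
  set v := ENNReal.ofReal Q.vol with hv
  set b := ∫⁻ x in Q.set, g x with hb
  have hv0 : v ≠ 0 := (ENNReal.ofReal_pos.2 Q.vol_pos_s17).ne'
  have hvt : v ≠ ∞ := ENNReal.ofReal_ne_top
  have hd0 : v ^ (γ / n - 1) ≠ 0 := (ENNReal.rpow_pos (pos_iff_ne_zero.2 hv0) hvt).ne'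
  have hdt : v ^ (γ / n - 1) ≠ ∞ := ENNReal.rpow_ne_top_of_ne_zero hv0 hvt
  have hc0 : v ^ (γ / n - 1) * b ≠ 0 := mul_ne_zero hd0 hg
  have hct : v ^ (γ / n - 1) * b ≠ ∞ := ENNReal.mul_ne_top hdt hg'
  have hint : ∫⁻ x in Q.set, f x * fracMax γ g x ^ (-s) ≤
      (∫⁻ x in Q.set, f x) * (v ^ (γ / n - 1) * b) ^ (-s) := by
    rw [← lintegral_mul_const' _ _ (ENNReal.rpow_ne_top_of_ne_zero hc0 hct)]
    refine setLIntegral_mono' Q.measurableSet_set fun x hx => ?_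
    refine mul_le_mul' le_rfl ?_
    rw [ENNReal.rpow_neg, ENNReal.rpow_neg]
    gcongr
    exact mul_lintegral_le_fracMax γ g Q hx
  calc avgE Q (fun x => f x * fracMax γ g x ^ (-s)) ^ r
      ≤ ((∫⁻ x in Q.set, f x) * (v ^ (γ / n - 1) * b) ^ (-s) / v) ^ r := by
        unfold avgE
        gcongr
    _ = _ := by
        rw [ENNReal.div_rpow_of_nonneg _ _ hr, ENNReal.mul_rpow_of_nonneg _ _ hr,
          ← ENNReal.rpow_mul, ENNReal.mul_rpow_of_ne_top hdt hg', ← ENNReal.rpow_mul,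
          div_eq_mul_inv, ← ENNReal.rpow_neg, sub_eq_add_neg ((1 - γ / n) * (s * r)),
          ENNReal.rpow_add _ _ hv0 hvt,
          show (γ / n - 1) * (-s * r) = (1 - γ / n) * (s * r) by ring, neg_mul]
        ring

/-- factored weights: with
`γ = (α/n + 1/q - 1/p) / ((1/n)(1 + 1/q - 1/p))`, the pair
`u = w₁ (M_γ w₂)^{-q/p'}`, `σ = w₂ (M_γ w₁)^{-p'/q}` satisfies `[u,σ]_{A^α_{p,q}} ≤ 1`. -/
theorem stmt17 (n : ℕ) (hn : 0 < n) (α p q : ℝ) (hα : 0 < α) (hαn : α < n)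
    (hp : 1 < p) (hpq : p ≤ q) (hs : 1 / p - 1 / q ≤ α / n)
    (γ : ℝ) (hγ : γ = (α / n + 1 / q - 1 / p) / ((1 / n) * (1 + 1 / q - 1 / p)))
    (w₁ w₂ : Rn n → ℝ)
    (h₁m : Measurable w₁) (h₁n : ∀ x, 0 ≤ w₁ x) (h₁l : LocallyIntegrable w₁ volume)
    (h₂m : Measurable w₂) (h₂n : ∀ x, 0 ≤ w₂ x) (h₂l : LocallyIntegrable w₂ volume) :
    ApqE α p q
        (fun x => ENNReal.ofReal (w₁ x) *
          fracMax γ (fun y => ENNReal.ofReal (w₂ y)) x ^ (-(q / conjExp p)))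
        (fun x => ENNReal.ofReal (w₂ x) *
          fracMax γ (fun y => ENNReal.ofReal (w₁ y)) x ^ (-(conjExp p / q))) ≤ 1 := by
  have hq : 0 < q := by linarith
  have hp' : 0 < conjExp p := div_pos (by linarith) (by linarith)
  have hconj : 1 / conjExp p = 1 - 1 / p := by
    have : p - 1 ≠ 0 := by linarith
    rw [conjExp]
    field_simp
  have hγn : γ / n * (1 / q + 1 / conjExp p) = α / n + 1 / q - 1 / p := by
    have hn' : (n : ℝ) ≠ 0 := by positivity
    have hpos : 1 + 1 / q - 1 / p ≠ 0 := by
      have h1 : 0 < 1 / q := by positivity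
      have h2 : 0 < 1 / conjExp p := by positivity
      linarith
    rw [hconj, hγ, show 1 / q + (1 - 1 / p) = 1 + 1 / q - 1 / p by ring]
    generalize 1 + 1 / q - 1 / p = d at hpos
    field_simp
  refine iSup_le fun Q => ?_
  by_cases ha : ∫⁻ x in Q.set, ENNReal.ofReal (w₁ x) = 0
  · rw [avgE_mul_eq_zero Q _ h₁m.ennreal_ofReal ha, ENNReal.zero_rpow_of_pos (by positivity)]
    simp
  by_cases hb : ∫⁻ x in Q.set, ENNReal.ofReal (w₂ x) = 0
  · rw [avgE_mul_eq_zero Q _ h₂m.ennreal_ofReal hb,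
      ENNReal.zero_rpow_of_pos (y := 1 / conjExp p) (by positivity)]
    simp
  have ha' := Q.setLIntegral_ofReal_ne_top h₁l
  have hb' := Q.setLIntegral_ofReal_ne_top h₂l
  have hu := avgE_mul_fracMax_rpow_le γ (s := q / conjExp p) (r := 1 / q) (by positivity)
    (by positivity) Q (fun x => ENNReal.ofReal (w₁ x)) _ hb hb'
  have hσ := avgE_mul_fracMax_rpow_le γ (s := conjExp p / q) (r := 1 / conjExp p) (by positivity)
    (by positivity) Q (fun x => ENNReal.ofReal (w₂ x)) _ ha ha'
  rw [show q / conjExp p * (1 / q) = 1 / conjExp p by field_simp] at hu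
  rw [show conjExp p / q * (1 / conjExp p) = 1 / q by field_simp] at hσ
  refine (mul_le_mul' (mul_le_mul' le_rfl hu) hσ).trans_eq ?_
  rw [← ENNReal.ofReal_rpow_of_pos Q.vol_pos_s17]
  have hv0 : ENNReal.ofReal Q.vol ≠ 0 := (ENNReal.ofReal_pos.2 Q.vol_pos_s17).ne'
  have hvt : ENNReal.ofReal Q.vol ≠ ∞ := ENNReal.ofReal_ne_top
  change ENNReal.ofReal Q.vol ^ _ * _ * _ = 1
  set v := ENNReal.ofReal Q.vol
  set a := ∫⁻ x in Q.set, ENNReal.ofReal (w₁ x)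
  set b := ∫⁻ x in Q.set, ENNReal.ofReal (w₂ x)
  calc _ = (a ^ (1 / q) * a ^ (-(1 / q))) * (b ^ (1 / conjExp p) * b ^ (-(1 / conjExp p))) *
        (v ^ (α / n + 1 / q - 1 / p) * v ^ ((1 - γ / n) * (1 / conjExp p) - 1 / q) *
          v ^ ((1 - γ / n) * (1 / q) - 1 / conjExp p)) := by ring
    _ = 1 := by
        rw [← ENNReal.rpow_add _ _ ha ha', ← ENNReal.rpow_add _ _ hb hb',
          ← ENNReal.rpow_add _ _ hv0 hvt, ← ENNReal.rpow_add _ _ hv0 hvt, ← hγn,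
          show γ / n * (1 / q + 1 / conjExp p) + ((1 - γ / n) * (1 / conjExp p) - 1 / q) +
            ((1 - γ / n) * (1 / q) - 1 / conjExp p) = 0 by ring]
        simp
end
end

section
/- Let 0≤γ<1 and define E = ⋃_{j≥0} [j, j+(j+1)^{−γ}) ⊂ ℝ. Then there exist constants c,C>0 depending only on γ such that M_γ(χ_E)(x) ≥ c for every x>0, and for every interval Q⊂ℝ one has |Q|^{γ−1}|Q∩E| ≤ C; in particular M_γ(χ_E)(x) ≍ 1 for x>0. -/
open MeasureTheory ENNReal Set

noncomputable section

/-- The set `E = ⋃_{j≥0} [j, j+(j+1)^{-γ})`. -/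
def Eset (γ : ℝ) : Set ℝ :=
  ⋃ j : ℕ, Ico (j : ℝ) ((j : ℝ) + ((j : ℝ) + 1) ^ (-γ))

theorem sum_rpow_neg_le {γ : ℝ} (hγ0 : 0 ≤ γ) (hγ1 : γ < 1) (n : ℕ) :
    ∑ i ∈ Finset.range n, ((i : ℝ) + 1) ^ (-γ) ≤ (n : ℝ) ^ (1 - γ) / (1 - γ) := by
  have hp : 0 < 1 - γ := by linarith
  induction n with
  | zero => simp [Real.zero_rpow hp.ne']
  | succ n ih =>
    rw [Finset.sum_range_succ]
    have hn : (0 : ℝ) < (n : ℝ) + 1 := by positivity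
    have hinv : ((n : ℝ) + 1)⁻¹ ≤ 1 := inv_le_one_of_one_le₀ (by linarith [n.cast_nonneg (α := ℝ)])
    have hbern : (1 + -((n : ℝ) + 1)⁻¹) ^ (1 - γ) ≤ 1 + (1 - γ) * -((n : ℝ) + 1)⁻¹ :=
      rpow_one_add_le_one_add_mul_self (by linarith) hp.le (by linarith)
    have hfac : (n : ℝ) = ((n : ℝ) + 1) * (1 + -((n : ℝ) + 1)⁻¹) := by field_simp; ring
    have hmul : (n : ℝ) ^ (1 - γ)
        = ((n : ℝ) + 1) ^ (1 - γ) * (1 + -((n : ℝ) + 1)⁻¹) ^ (1 - γ) := by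
      conv_lhs => rw [hfac]
      exact Real.mul_rpow hn.le (by linarith)
    have hneg : ((n : ℝ) + 1) ^ (-γ) = ((n : ℝ) + 1) ^ (1 - γ) * ((n : ℝ) + 1)⁻¹ := by
      rw [← Real.rpow_neg_one, ← Real.rpow_add hn]
      congr 1
      ring
    have hstep := mul_le_mul_of_nonneg_left hbern (Real.rpow_nonneg hn.le (1 - γ))
    rw [← hmul] at hstep
    push_cast
    rw [le_div_iff₀ hp] at ih ⊢
    rw [add_mul, hneg]
    linarith

theorem measurableSet_Eset (γ : ℝ) : MeasurableSet (Eset γ) :=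
  MeasurableSet.iUnion fun _ => measurableSet_Ico

theorem lintegral_indicator_Eset (γ a b : ℝ) :
    ∫⁻ y in Ioo a b, (Eset γ).indicator (fun _ => (1 : ℝ≥0∞)) y = volume (Ioo a b ∩ Eset γ) := by
  rw [lintegral_indicator (measurableSet_Eset γ), setLIntegral_one,
    Measure.restrict_apply (measurableSet_Eset γ), inter_comm]

theorem rpow_neg_cast_succ_le_one {γ : ℝ} (hγ0 : 0 ≤ γ) (j : ℕ) : ((j : ℝ) + 1) ^ (-γ) ≤ 1 :=
  Real.rpow_le_one_of_one_le_of_nonpos (by linarith [j.cast_nonneg (α := ℝ)]) (by linarith)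

theorem floor_eq_of_mem_Ico {γ : ℝ} (hγ0 : 0 ≤ γ) {j : ℕ} {y : ℝ}
    (hy : y ∈ Ico (j : ℝ) ((j : ℝ) + ((j : ℝ) + 1) ^ (-γ))) : ⌊y⌋₊ = j :=
  (Nat.floor_eq_iff (j.cast_nonneg.trans hy.1)).2
    ⟨hy.1, hy.2.trans_le (by linarith [rpow_neg_cast_succ_le_one hγ0 j])⟩

theorem rpow_le_volume_Ioo_inter_Eset {γ : ℝ} (hγ0 : 0 ≤ γ) {N : ℕ} (hN : 0 < N) :
    ENNReal.ofReal ((N : ℝ) ^ (1 - γ)) ≤ volume (Ioo 0 (N : ℝ) ∩ Eset γ) := by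
  have hN' : (0 : ℝ) < N := Nat.cast_pos.2 hN
  have hsub : (⋃ j ∈ Finset.range N, Ioo (j : ℝ) ((j : ℝ) + ((j : ℝ) + 1) ^ (-γ)))
      ⊆ Ioo 0 (N : ℝ) ∩ Eset γ := by
    refine iUnion₂_subset fun j hj y hy => ⟨⟨j.cast_nonneg.trans_lt hy.1, ?_⟩,
      mem_iUnion.2 ⟨j, Ioo_subset_Ico_self hy⟩⟩
    have : (j : ℝ) + 1 ≤ N := by exact_mod_cast Finset.mem_range.1 hj
    linarith [hy.2, rpow_neg_cast_succ_le_one hγ0 j]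
  have hdisj : (↑(Finset.range N) : Set ℕ).PairwiseDisjoint
      fun j : ℕ => Ioo (j : ℝ) ((j : ℝ) + ((j : ℝ) + 1) ^ (-γ)) := by
    refine fun i _ j _ hij => Set.disjoint_left.2 fun y hi hj => hij ?_
    rw [← floor_eq_of_mem_Ico hγ0 (Ioo_subset_Ico_self hi),
      floor_eq_of_mem_Ico hγ0 (Ioo_subset_Ico_self hj)]
  refine le_trans ?_ (measure_mono hsub)
  rw [measure_biUnion_finset hdisj fun _ _ => measurableSet_Ioo]
  simp only [Real.volume_Ioo, add_sub_cancel_left]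
  rw [← ENNReal.ofReal_sum_of_nonneg fun i _ => by positivity]
  refine ENNReal.ofReal_le_ofReal ?_
  have hconst : (N : ℝ) ^ (1 - γ) = ∑ _j ∈ Finset.range N, (N : ℝ) ^ (-γ) := by
    rw [Finset.sum_const, Finset.card_range, nsmul_eq_mul, sub_eq_add_neg, Real.rpow_add hN',
      Real.rpow_one]
  rw [hconst]
  refine Finset.sum_le_sum fun j hj => Real.rpow_le_rpow_of_nonpos (by positivity) ?_ (by linarith)
  exact_mod_cast Finset.mem_range.1 hj

theorem volume_Ioo_inter_Eset_le {γ : ℝ} (hγ0 : 0 ≤ γ) (hγ1 : γ < 1) (a b : ℝ) :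
    volume (Ioo a b ∩ Eset γ)
      ≤ ENNReal.ofReal ((⌈b - a + 1⌉₊ : ℝ) ^ (1 - γ) / (1 - γ)) := by
  set n := ⌈b - a + 1⌉₊
  set m := ⌊a⌋₊
  have hsub : Ioo a b ∩ Eset γ ⊆ ⋃ i ∈ Finset.range n,
      Ico ((m + i : ℕ) : ℝ) (((m + i : ℕ) : ℝ) + (((m + i : ℕ) : ℝ) + 1) ^ (-γ)) := by
    rintro y ⟨hy, hyE⟩
    obtain ⟨j, hj⟩ := mem_iUnion.1 hyE
    have hmj : m ≤ j := by
      rw [← floor_eq_of_mem_Ico hγ0 hj]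
      exact Nat.floor_mono hy.1.le
    obtain ⟨i, rfl⟩ := Nat.exists_eq_add_of_le hmj
    refine mem_iUnion₂.2 ⟨i, Finset.mem_range.2 (Nat.lt_ceil.2 ?_), hj⟩
    have hlow := hj.1
    push_cast at hlow
    linarith [Nat.lt_floor_add_one a, hy.2]
  refine (measure_mono hsub).trans ((measure_biUnion_finset_le _ _).trans ?_)
  simp only [Real.volume_Ico, add_sub_cancel_left]
  rw [← ENNReal.ofReal_sum_of_nonneg fun i _ => by positivity]
  refine ENNReal.ofReal_le_ofReal ((Finset.sum_le_sum fun i _ => ?_).trans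
    (sum_rpow_neg_le hγ0 hγ1 n))
  refine Real.rpow_le_rpow_of_nonpos (by positivity) ?_ (by linarith)
  push_cast
  linarith [m.cast_nonneg (α := ℝ)]

theorem rpow_mul_volume_Ioo_inter_Eset_le {γ : ℝ} (hγ0 : 0 ≤ γ) (hγ1 : γ < 1) {a b : ℝ}
    (hab : a < b) :
    ENNReal.ofReal ((b - a) ^ (γ - 1)) * volume (Ioo a b ∩ Eset γ)
      ≤ ENNReal.ofReal (3 ^ (1 - γ) / (1 - γ)) := by
  have hl : 0 < b - a := sub_pos.2 hab
  have hp : 0 < 1 - γ := by linarith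
  rcases le_or_gt (b - a) 1 with h | h
  · calc ENNReal.ofReal ((b - a) ^ (γ - 1)) * volume (Ioo a b ∩ Eset γ)
        ≤ ENNReal.ofReal ((b - a) ^ (γ - 1)) * ENNReal.ofReal (b - a) := by
          rw [← Real.volume_Ioo]
          gcongr
          exact inter_subset_left
      _ = ENNReal.ofReal ((b - a) ^ γ) := by
          rw [← ENNReal.ofReal_mul (by positivity), ← Real.rpow_add_one hl.ne', sub_add_cancel]
      _ ≤ ENNReal.ofReal (3 ^ (1 - γ) / (1 - γ)) := by
          refine ENNReal.ofReal_le_ofReal ((Real.rpow_le_one hl.le h hγ0).trans ?_)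
          rw [one_le_div hp]
          linarith [Real.one_le_rpow (by norm_num : (1 : ℝ) ≤ 3) hp.le]
  · calc ENNReal.ofReal ((b - a) ^ (γ - 1)) * volume (Ioo a b ∩ Eset γ)
        ≤ ENNReal.ofReal ((b - a) ^ (γ - 1)) *
            ENNReal.ofReal ((3 * (b - a)) ^ (1 - γ) / (1 - γ)) := by
          refine mul_le_mul_right ((volume_Ioo_inter_Eset_le hγ0 hγ1 a b).trans
            (ENNReal.ofReal_le_ofReal ?_)) _
          gcongr
          linarith [Nat.ceil_lt_add_one (by linarith : 0 ≤ b - a + 1)]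
      _ = ENNReal.ofReal (3 ^ (1 - γ) / (1 - γ)) := by
          rw [← ENNReal.ofReal_mul (by positivity), Real.mul_rpow (by norm_num) hl.le]
          have hone : (b - a) ^ (γ - 1) * (b - a) ^ (1 - γ) = 1 := by
            rw [← Real.rpow_add hl, show γ - 1 + (1 - γ) = 0 by ring, Real.rpow_zero]
          congr 1
          linear_combination (3 ^ (1 - γ) / (1 - γ)) * hone

/-- for `0 ≤ γ < 1` and `E = ⋃_{j≥0}[j, j+(j+1)^{-γ})`, one has
`M_γ(χ_E)(x) ≥ c` for all `x > 0`, `|Q|^{γ-1}|Q∩E| ≤ C` for every interval `Q`, and in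
particular `M_γ(χ_E)(x) ≍ 1` for `x > 0`. -/
theorem stmt18 (γ : ℝ) (hγ0 : 0 ≤ γ) (hγ1 : γ < 1) :
    ∃ c C : ℝ, 0 < c ∧ 0 < C ∧
      (∀ x : ℝ, 0 < x →
        ENNReal.ofReal c ≤ fm1 γ ((Eset γ).indicator fun _ => (1 : ℝ≥0∞)) x) ∧
      (∀ a b : ℝ, a < b →
        ENNReal.ofReal ((b - a) ^ (γ - 1)) * volume (Ioo a b ∩ Eset γ) ≤
          ENNReal.ofReal C) ∧
      (∀ x : ℝ, 0 < x →
        fm1 γ ((Eset γ).indicator fun _ => (1 : ℝ≥0∞)) x ≤ ENNReal.ofReal C) := by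
  have hp : 0 < 1 - γ := by linarith
  have hupper := fun a b : ℝ => rpow_mul_volume_Ioo_inter_Eset_le hγ0 hγ1 (a := a) (b := b)
  refine ⟨1, 3 ^ (1 - γ) / (1 - γ), one_pos, by positivity, fun x hx => ?_, hupper, fun x _ => ?_⟩
  · have hN : (0 : ℝ) < (⌊x⌋₊ + 1 : ℕ) := by positivity
    have hxN : x ∈ Icc (0 : ℝ) (⌊x⌋₊ + 1 : ℕ) :=
      ⟨hx.le, by push_cast; exact (Nat.lt_floor_add_one x).le⟩
    refine le_trans ?_ (le_iSup₂_of_le (0 : ℝ) ((⌊x⌋₊ + 1 : ℕ) : ℝ)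
      (le_iSup₂_of_le hN hxN le_rfl))
    rw [lintegral_indicator_Eset, sub_zero]
    refine le_trans (le_of_eq ?_)
      (mul_le_mul_right (rpow_le_volume_Ioo_inter_Eset hγ0 ⌊x⌋₊.succ_pos) _)
    rw [← ENNReal.ofReal_mul (by positivity), Nat.succ_eq_add_one, ← Real.rpow_add hN,
      show γ - 1 + (1 - γ) = 0 by ring, Real.rpow_zero]
  · refine iSup₂_le fun a b => iSup₂_le fun hab _ => ?_
    rw [lintegral_indicator_Eset]
    exact hupper a b hab
end
end
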